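/- There exists μ₀ ∈ (0, 1/2] such that for every μ ∈ (0, μ₀) and every ε > 0 the planar circular restricted three-body problem with mass ratio μ has a solution (q(t), p(t)) defined for all t ∈ ℝ which is parabolic in both time directions, i.e. ‖q(t)‖ → +∞ and ‖p(t)‖ → 0 as t → +∞ and as t → −∞, and which passes ε-close to collision with the first primary: inf_{t∈ℝ} ‖q(t) + (μ,0)‖ ≤ ε. -/

import Mathlib

open Real Filter MeasureTheory
open scoped Topology

/-- Euclidean norm of a planar vector given by its components. -/
noncomputable def nrm2 (x y : ℝ) : ℝ := Real.sqrt (x ^ 2 + y ^ 2)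

/-- Distance from `(x,y)` to the first (massive) primary, located at `(-μ,0)`. -/
noncomputable def dS (μ x y : ℝ) : ℝ := Real.sqrt ((x + μ) ^ 2 + y ^ 2)

/-- Distance from `(x,y)` to the second primary, located at `(1-μ,0)`. -/
noncomputable def dJ (μ x y : ℝ) : ℝ := Real.sqrt ((x - (1 - μ)) ^ 2 + y ^ 2)

/-- `(q₁,q₂,p₁,p₂)` is a solution of the planar circular restricted three-body problem
with mass ratio `μ` on the set `I` of times: it avoids the two singularities and satisfies
Hamilton's equations `q̇ = ∂H/∂p`, `ṗ = -∂H/∂q` for the Hamiltonian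
`H(q,p;μ) = ‖p‖²/2 - q₁p₂ + q₂p₁ - (1-μ)/‖q+(μ,0)‖ - μ/‖q-(1-μ,0)‖`,
whose partial derivatives have been computed explicitly. -/
def IsPCRTBPSol (μ : ℝ) (I : Set ℝ) (q1 q2 p1 p2 : ℝ → ℝ) : Prop :=
  ∀ t ∈ I,
    ((q1 t, q2 t) ≠ (-μ, 0) ∧ (q1 t, q2 t) ≠ (1 - μ, 0)) ∧
    HasDerivAt q1 (p1 t + q2 t) t ∧
    HasDerivAt q2 (p2 t - q1 t) t ∧
    HasDerivAt p1 (p2 t - (1 - μ) * (q1 t + μ) / (dS μ (q1 t) (q2 t)) ^ 3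
        - μ * (q1 t - (1 - μ)) / (dJ μ (q1 t) (q2 t)) ^ 3) t ∧
    HasDerivAt p2 (-(p1 t) - (1 - μ) * (q2 t) / (dS μ (q1 t) (q2 t)) ^ 3
        - μ * (q2 t) / (dJ μ (q1 t) (q2 t)) ^ 3) t


section GlobalFlow

variable {E : Type*} [NormedAddCommGroup E] [NormedSpace ℝ E]

/-- Picard–Lindelöf for a globally Lipschitz field, on a time interval depending only on the
Lipschitz constant. -/
lemma exists_solution_Icc_short [CompleteSpace E] {K : NNReal} {f : E → E}
    (hf : LipschitzWith K f) (x : E) :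
    ∃ α : ℝ → E, α 0 = x ∧ ∀ t ∈ Set.Icc (0 : ℝ) (1 / (2 * (K + 1))),
      HasDerivWithinAt α (f (α t)) (Set.Icc 0 (1 / (2 * (K + 1)))) t := by
  set T : ℝ := 1 / (2 * (K + 1)) with hT
  have hK : (0 : ℝ) ≤ K := K.2
  have hTpos : 0 < T := by positivity
  have hKT : K * T ≤ 1 / 2 := by
    rw [hT, mul_one_div, div_le_div_iff₀ (by positivity) (by norm_num)]; linarith
  let a : NNReal := ⟨2 * T * ‖f x‖, by positivity⟩
  let L : NNReal := ⟨‖f x‖ + K * a, by positivity⟩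
  have hP : IsPicardLindelof (fun _ => f) (⟨0, le_rfl, hTpos.le⟩ : Set.Icc (0 : ℝ) T)
      x a 0 L K := by
    refine IsPicardLindelof.of_time_independent ?_ (hf.lipschitzOnWith) ?_
    · intro y hy
      have h1 : ‖f y - f x‖ ≤ K * ‖y - x‖ := hf.norm_sub_le y x
      have h2 : ‖y - x‖ ≤ a := by simpa [dist_eq_norm] using hy
      have h3 : ‖f y‖ ≤ ‖f x‖ + ‖f y - f x‖ := norm_le_insert' (f y) (f x)
      have h4 : (K : ℝ) * ‖y - x‖ ≤ K * a := by gcongr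
      change ‖f y‖ ≤ ‖f x‖ + K * a
      linarith
    · change (‖f x‖ + K * (2 * T * ‖f x‖)) * max (T - 0) (0 - 0) ≤ 2 * T * ‖f x‖ - 0
      rw [sub_zero, sub_zero, max_eq_left hTpos.le]
      nlinarith [mul_le_mul_of_nonneg_right hKT (by positivity : 0 ≤ T * ‖f x‖)]
  obtain ⟨α, h0, hα⟩ := hP.exists_eq_forall_mem_Icc_hasDerivWithinAt₀
  exact ⟨α, h0, hα⟩

/-- Concatenation of two integral curves. -/
lemma exists_solution_Icc_add {f : E → E} {x : E} {S T : ℝ} (hS : 0 ≤ S) (hT : 0 ≤ T)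
    {α β : ℝ → E} (hα0 : α 0 = x)
    (hα : ∀ t ∈ Set.Icc 0 S, HasDerivWithinAt α (f (α t)) (Set.Icc 0 S) t)
    (hβ0 : β 0 = α S)
    (hβ : ∀ t ∈ Set.Icc 0 T, HasDerivWithinAt β (f (β t)) (Set.Icc 0 T) t) :
    ∃ γ : ℝ → E, γ 0 = x ∧
      ∀ t ∈ Set.Icc 0 (S + T), HasDerivWithinAt γ (f (γ t)) (Set.Icc 0 (S + T)) t := by
  let γ : ℝ → E := fun t => if t ≤ S then α t else β (t - S)
  have hγα : ∀ t, t ≤ S → γ t = α t := fun t ht => if_pos ht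
  have hγβ : ∀ t, S ≤ t → γ t = β (t - S) := by
    intro t ht
    rcases ht.eq_or_lt with rfl | h
    · simp [γ, hβ0]
    · exact if_neg (not_le.2 h)
  have hβ' : ∀ t ∈ Set.Icc S (S + T),
      HasDerivWithinAt (fun t => β (t - S)) (f (β (t - S))) (Set.Icc S (S + T)) t := by
    intro t ht
    have h1 := hβ (t - S) ⟨by linarith [ht.1], by linarith [ht.2]⟩
    have h2 : HasDerivWithinAt (fun t : ℝ => t - S) 1 (Set.Icc S (S + T)) t :=
      ((hasDerivAt_id t).sub_const S).hasDerivWithinAt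
    have hmaps : Set.MapsTo (fun t : ℝ => t - S) (Set.Icc S (S + T)) (Set.Icc 0 T) :=
      fun y hy => ⟨by linarith [hy.1], by linarith [hy.2]⟩
    simpa [Function.comp_def] using h1.scomp t h2 hmaps
  have hunion : Set.Icc 0 (S + T) = Set.Icc 0 S ∪ Set.Icc S (S + T) :=
    (Set.Icc_union_Icc_eq_Icc hS (by linarith)).symm
  refine ⟨γ, by rw [hγα 0 hS, hα0], fun t ht => ?_⟩
  rw [hunion]
  have hleft : t ∈ Set.Icc 0 S → HasDerivWithinAt γ (f (γ t)) (Set.Icc 0 S) t := fun h => by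
    rw [hγα t h.2]
    exact (hα t h).congr (fun y hy => hγα y hy.2) (hγα t h.2)
  have hright : t ∈ Set.Icc S (S + T) →
      HasDerivWithinAt γ (f (γ t)) (Set.Icc S (S + T)) t := fun h => by
    rw [hγβ t h.1]
    exact (hβ' t h).congr (fun y hy => hγβ y hy.1) (hγβ t h.1)
  have hempty : ∀ {s : Set ℝ}, IsClosed s → t ∉ s → HasDerivWithinAt γ (f (γ t)) s t :=
    fun hs h => HasFDerivWithinAt.of_notMem_closure (by rwa [hs.closure_eq])
  refine HasDerivWithinAt.union ?_ ?_
  · by_cases h : t ∈ Set.Icc 0 S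
    · exact hleft h
    · exact hempty isClosed_Icc h
  · by_cases h : t ∈ Set.Icc S (S + T)
    · exact hright h
    · exact hempty isClosed_Icc h

lemma exists_solution_Ici [CompleteSpace E] {K : NNReal} {f : E → E}
    (hf : LipschitzWith K f) (x : E) :
    ∃ α : ℝ → E, α 0 = x ∧ ∀ t ∈ Set.Ici (0 : ℝ),
      HasDerivWithinAt α (f (α t)) (Set.Ici 0) t := by
  set T : ℝ := 1 / (2 * (K + 1)) with hT
  have hTpos : 0 < T := by have : (0 : ℝ) ≤ K := K.2; positivity
  have hn : ∀ n : ℕ, ∃ α : ℝ → E, α 0 = x ∧ ∀ t ∈ Set.Icc (0 : ℝ) (n * T),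
      HasDerivWithinAt α (f (α t)) (Set.Icc 0 (n * T)) t := by
    intro n
    induction n with
    | zero =>
      refine ⟨fun _ => x, rfl, fun t ht => ?_⟩
      have : t = 0 := le_antisymm (by simpa using ht.2) ht.1
      subst this
      simp only [Nat.cast_zero, zero_mul, Set.Icc_self]
      exact HasFDerivWithinAt.of_subsingleton Set.subsingleton_singleton
    | succ n ih =>
      obtain ⟨α, h0, hα⟩ := ih
      obtain ⟨β, hβ0, hβ⟩ := exists_solution_Icc_short hf (α (n * T))
      have := exists_solution_Icc_add (by positivity) hTpos.le h0 hα hβ0 hβ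
      rwa [show (n : ℝ) * T + T = ((n + 1 : ℕ) : ℝ) * T by push_cast; ring] at this
  choose α hα0 hα using hn
  have huniq : ∀ m n : ℕ, ∀ t, 0 ≤ t → t ≤ m * T → t ≤ n * T → α m t = α n t := by
    intro m n t ht htm htn
    have key : ∀ k : ℕ, t ≤ k * T → ContinuousOn (α k) (Set.Icc 0 t) ∧
        ∀ s ∈ Set.Ico 0 t, HasDerivWithinAt (α k) (f (α k s)) (Set.Ici s) s := by
      intro k hk
      refine ⟨fun s hs => ((hα k s ⟨hs.1, hs.2.trans hk⟩).continuousWithinAt).mono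
        (Set.Icc_subset_Icc_right hk), fun s hs => ?_⟩
      have h1 := (hα k s ⟨hs.1, hs.2.le.trans hk⟩).mono
        (Set.Icc_subset_Icc hs.1 hk : Set.Icc s t ⊆ _)
      exact h1.mono_of_mem_nhdsWithin (Icc_mem_nhdsGE hs.2)
    exact ODE_solution_unique (v := fun _ => f) (fun _ => hf) (key m htm).1 (key m htm).2
      (key n htn).1 (key n htn).2 (by rw [hα0, hα0]) ⟨ht, le_rfl⟩
  let N : ℝ → ℕ := fun t => ⌈t / T⌉₊ + 1
  have hN : ∀ t, t < N t * T := by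
    intro t
    have := Nat.le_ceil (t / T)
    rw [div_le_iff₀ hTpos] at this
    have : t < (⌈t / T⌉₊ + 1) * T := by linarith
    simpa [N] using this
  refine ⟨fun t => α (N t) t, hα0 _, fun t ht => ?_⟩
  have ht : 0 ≤ t := ht
  have h1 := hα (N t) t ⟨ht, (hN t).le⟩
  have h2 : HasDerivWithinAt (fun s => α (N s) s) (f (α (N t) t))
      (Set.Icc 0 (N t * T)) t :=
    h1.congr (fun s hs => huniq _ _ s hs.1 (hN s).le hs.2) rfl
  refine h2.mono_of_mem_nhdsWithin ?_
  rw [← Set.Ici_inter_Iic, Set.inter_comm]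
  exact inter_mem_nhdsWithin _ (Iic_mem_nhds (hN t)) |> fun h => by
    rwa [Set.inter_comm] at h

lemma exists_solution_univ [CompleteSpace E] {K : NNReal} {f : E → E}
    (hf : LipschitzWith K f) (x : E) :
    ∃ α : ℝ → E, α 0 = x ∧ ∀ t, HasDerivAt α (f (α t)) t := by
  obtain ⟨α, hα0, hα⟩ := exists_solution_Ici hf x
  obtain ⟨β, hβ0, hβ⟩ := exists_solution_Ici (f := fun y => -f y) hf.neg x
  let γ : ℝ → E := fun t => if 0 ≤ t then α t else β (-t)
  have hγα : ∀ t ∈ Set.Ici (0 : ℝ), γ t = α t := fun t ht => if_pos ht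
  have hγβ : ∀ t ∈ Set.Iic (0 : ℝ), γ t = β (-t) := by
    intro t ht
    rcases (show t ≤ 0 from ht).eq_or_lt with rfl | h
    · simp [γ, hα0, hβ0]
    · exact if_neg (not_le.2 h)
  have hR : ∀ t ∈ Set.Ici (0 : ℝ), HasDerivWithinAt γ (f (γ t)) (Set.Ici 0) t := by
    intro t ht
    rw [hγα t ht]
    exact (hα t ht).congr hγα (hγα t ht)
  have hL : ∀ t ∈ Set.Iic (0 : ℝ), HasDerivWithinAt γ (f (γ t)) (Set.Iic 0) t := by
    intro t ht
    have ht' : t ≤ 0 := ht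
    have h1 := hβ (-t) (show (0 : ℝ) ≤ -t by linarith)
    have h2 : HasDerivWithinAt (fun t : ℝ => -t) (-1) (Set.Iic 0) t :=
      (hasDerivAt_neg t).hasDerivWithinAt
    have h3 := h1.scomp t h2 (fun y hy => by
      have : y ≤ 0 := hy
      show (0 : ℝ) ≤ -y
      linarith)
    rw [hγβ t ht]
    refine HasDerivWithinAt.congr ?_ hγβ (hγβ t ht)
    simpa [Function.comp_def] using h3
  refine ⟨γ, by rw [hγα 0 (le_refl (0 : ℝ)), hα0], fun t => ?_⟩
  rcases lt_trichotomy t 0 with h | h | h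
  · exact (hL t h.le).hasDerivAt (Iic_mem_nhds h)
  · subst h
    have := (hL 0 (le_refl (0 : ℝ))).union (hR 0 (le_refl (0 : ℝ)))
    rwa [Set.Iic_union_Ici, hasDerivWithinAt_univ] at this
  · exact (hR t h.le).hasDerivAt (Ici_mem_nhds h)

lemma dist_solution_le {K : NNReal} {f : E → E} (hf : LipschitzWith K f) {α β : ℝ → E}
    (hα : ∀ t, HasDerivAt α (f (α t)) t) (hβ : ∀ t, HasDerivAt β (f (β t)) t) {t : ℝ}
    (ht : 0 ≤ t) : dist (α t) (β t) ≤ dist (α 0) (β 0) * Real.exp (K * t) := by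
  have := dist_le_of_trajectories_ODE (v := fun _ => f) (fun _ => hf) (a := 0) (b := t)
    (fun s _ => (hα s).continuousAt.continuousWithinAt) (fun s _ => (hα s).hasDerivWithinAt)
    (fun s _ => (hβ s).continuousAt.continuousWithinAt) (fun s _ => (hβ s).hasDerivWithinAt)
    le_rfl t ⟨ht, le_rfl⟩
  simpa using this

/-- A globally Lipschitz field has global solutions through any continuous family of initial
points, and these depend continuously on the parameter and on time. -/
lemma exists_continuous_family_solution [CompleteSpace E] {K : NNReal} {f : E → E}
    (hf : LipschitzWith K f) {x : ℝ → E} (hx : Continuous x) :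
    ∃ φ : ℝ → ℝ → E, (∀ k, φ k 0 = x k) ∧ (∀ k t, HasDerivAt (φ k) (f (φ k t)) t) ∧
      ContinuousOn (fun y : ℝ × ℝ => φ y.1 y.2) {y | 0 ≤ y.2} := by
  choose φ h0 hφ using fun k => exists_solution_univ hf (x k)
  refine ⟨φ, h0, hφ, fun y hy => ?_⟩
  rw [ContinuousWithinAt, tendsto_iff_dist_tendsto_zero]
  have hlim : Tendsto (fun z : ℝ × ℝ => dist (x z.1) (x y.1) * Real.exp (K * z.2)
      + dist (φ y.1 z.2) (φ y.1 y.2)) (𝓝[{y | 0 ≤ y.2}] y)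
      (𝓝 (dist (x y.1) (x y.1) * Real.exp (K * y.2) + dist (φ y.1 y.2) (φ y.1 y.2))) := by
    have hc : Continuous (φ y.1) := continuous_iff_continuousAt.2 fun t => (hφ y.1 t).continuousAt
    have : Continuous (fun z : ℝ × ℝ => dist (x z.1) (x y.1) * Real.exp (K * z.2)
      + dist (φ y.1 z.2) (φ y.1 y.2)) := by fun_prop
    exact (this.tendsto y).mono_left nhdsWithin_le_nhds
  rw [dist_self, dist_self, zero_mul, add_zero] at hlim
  refine squeeze_zero' (Eventually.of_forall fun _ => dist_nonneg) ?_ hlim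
  filter_upwards [self_mem_nhdsWithin] with z hz
  calc dist (φ z.1 z.2) (φ y.1 y.2)
      ≤ dist (φ z.1 z.2) (φ y.1 z.2) + dist (φ y.1 z.2) (φ y.1 y.2) := dist_triangle _ _ _
    _ ≤ _ := by
      gcongr
      rw [← h0, ← h0]
      exact dist_solution_le hf (hφ _) (hφ _) hz

end GlobalFlow
/-! ### The vector field with truncated singularities -/

lemma abs_sqrt_sub_sqrt_le (x y x' y' : ℝ) :
    |√(x ^ 2 + y ^ 2) - √(x' ^ 2 + y' ^ 2)| ≤ |x - x'| + |y - y'| := by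
  have key : ∀ a b a' b' : ℝ,
      √(a ^ 2 + b ^ 2) ≤ √(a' ^ 2 + b' ^ 2) + (|a - a'| + |b - b'|) := by
    intro a b a' b'
    have h1 : |a'| ≤ √(a' ^ 2 + b' ^ 2) := Real.abs_le_sqrt (by nlinarith [sq_nonneg b'])
    have h2 : |b'| ≤ √(a' ^ 2 + b' ^ 2) := Real.abs_le_sqrt (by nlinarith [sq_nonneg a'])
    have h3 : √(a' ^ 2 + b' ^ 2) ^ 2 = a' ^ 2 + b' ^ 2 := Real.sq_sqrt (by positivity)
    refine Real.sqrt_le_iff.2 ⟨by positivity, ?_⟩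
    have h4 : a ^ 2 = a' ^ 2 + 2 * (a' * (a - a')) + |a - a'| ^ 2 := by rw [sq_abs]; ring
    have h5 : b ^ 2 = b' ^ 2 + 2 * (b' * (b - b')) + |b - b'| ^ 2 := by rw [sq_abs]; ring
    have h6 : a' * (a - a') ≤ √(a' ^ 2 + b' ^ 2) * |a - a'| :=
      (le_abs_self _).trans (by rw [abs_mul]; gcongr)
    have h7 : b' * (b - b') ≤ √(a' ^ 2 + b' ^ 2) * |b - b'| :=
      (le_abs_self _).trans (by rw [abs_mul]; gcongr)
    nlinarith [mul_nonneg (abs_nonneg (a - a')) (abs_nonneg (b - b'))]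
  rw [abs_le]
  constructor
  · have := key x' y' x y
    rw [abs_sub_comm x', abs_sub_comm y'] at this
    linarith
  · linarith [key x y x' y']

lemma abs_div_cube_sub_div_cube_le {c x x' M M' : ℝ} (hc : 0 < c) (hM : c ≤ M) (hM' : c ≤ M')
    (hx' : |x'| ≤ M') :
    |x / M ^ 3 - x' / M' ^ 3| ≤ 3 / c ^ 3 * (|x - x'| + |M - M'|) := by
  have hMp : 0 < M := hc.trans_le hM
  have hMp' : 0 < M' := hc.trans_le hM'
  have e : x / M ^ 3 - x' / M' ^ 3 = (x - x') * (1 / M ^ 3)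
      + x' / M' * ((M' - M) * (1 / M ^ 3 + 1 / (M ^ 2 * M') + 1 / (M * M' ^ 2))) := by
    field_simp
    ring
  have b1 : 1 / M ^ 3 ≤ 1 / c ^ 3 := by gcongr
  have b2 : 1 / (M ^ 2 * M') ≤ 1 / c ^ 3 := by
    rw [pow_succ c 2]; gcongr
  have b3 : 1 / (M * M' ^ 2) ≤ 1 / c ^ 3 := by
    rw [pow_succ' c 2]; gcongr
  have b4 : |x' / M'| ≤ 1 := by
    rw [abs_div, abs_of_pos hMp']; exact (div_le_one hMp').2 hx'
  rw [e]
  refine (abs_add_le _ _).trans ?_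
  rw [abs_mul, abs_mul, abs_mul, abs_sub_comm M' M,
    abs_of_pos (by positivity : 0 < 1 / M ^ 3),
    abs_of_pos (by positivity : 0 < 1 / M ^ 3 + 1 / (M ^ 2 * M') + 1 / (M * M' ^ 2))]
  have hc3 : 0 < 1 / c ^ 3 := by positivity
  have t1 : |x - x'| * (1 / M ^ 3) ≤ |x - x'| * (1 / c ^ 3) := by gcongr
  have t2 : |x' / M'| * (|M - M'| * (1 / M ^ 3 + 1 / (M ^ 2 * M') + 1 / (M * M' ^ 2)))
      ≤ 1 * (|M - M'| * (1 / c ^ 3 + 1 / c ^ 3 + 1 / c ^ 3)) := by gcongr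
  have : 3 / c ^ 3 = 3 * (1 / c ^ 3) := by ring
  rw [this]
  nlinarith [abs_nonneg (x - x'), mul_nonneg (abs_nonneg (x - x')) hc3.le]

/-- The first component of the Newtonian force field at `(x, y)`, truncated at distance `c`
from the centre. -/
noncomputable def cutForce (c x y : ℝ) : ℝ := x / max √(x ^ 2 + y ^ 2) c ^ 3

lemma abs_cutForce_sub_le {c : ℝ} (hc : 0 < c) (x y x' y' : ℝ) :
    |cutForce c x y - cutForce c x' y'| ≤ 6 / c ^ 3 * (|x - x'| + |y - y'|) := by
  have h1 : |x'| ≤ max √(x' ^ 2 + y' ^ 2) c :=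
    (Real.abs_le_sqrt (by nlinarith [sq_nonneg y'])).trans (le_max_left _ _)
  have h2 := abs_div_cube_sub_div_cube_le (x := x) hc
    (le_max_right √(x ^ 2 + y ^ 2) c) (le_max_right _ _) h1
  have h3 : |max √(x ^ 2 + y ^ 2) c - max √(x' ^ 2 + y' ^ 2) c| ≤ |x - x'| + |y - y'| := by
    refine (abs_max_sub_max_le_abs _ _ _).trans (abs_sqrt_sub_sqrt_le x y x' y')
  have h4 : 6 / c ^ 3 = 2 * (3 / c ^ 3) := by ring
  have h5 : 0 < 3 / c ^ 3 := by positivity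
  unfold cutForce
  rw [h4]
  have h6 := mul_nonneg h5.le (abs_nonneg (y - y'))
  have h7 := mul_nonneg h5.le (abs_nonneg (x - x'))
  nlinarith [mul_le_mul_of_nonneg_left h3 h5.le, h6, h7]

/-- The vector field of the restricted three-body problem, with the force of the first primary
truncated at distance `c` and that of the second primary at distance `c'`. -/
noncomputable def cutField (μ c c' : ℝ) (v : ℝ × ℝ × ℝ × ℝ) : ℝ × ℝ × ℝ × ℝ :=
  (v.2.2.1 + v.2.1, v.2.2.2 - v.1,
    v.2.2.2 - (1 - μ) * cutForce c (v.1 + μ) v.2.1 - μ * cutForce c' (v.1 - (1 - μ)) v.2.1,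
    -v.2.2.1 - (1 - μ) * cutForce c v.2.1 (v.1 + μ) - μ * cutForce c' v.2.1 (v.1 - (1 - μ)))

lemma exists_lipschitzWith_cutField {μ c c' : ℝ} (hμ0 : 0 ≤ μ) (hμ1 : μ ≤ 1) (hc : 0 < c)
    (hc' : 0 < c') : ∃ K, LipschitzWith K (cutField μ c c') := by
  refine ⟨⟨2 + 2 * (6 / c ^ 3) + 2 * (6 / c' ^ 3), by positivity⟩,
    LipschitzWith.of_dist_le_mul fun v w => ?_⟩
  set d := dist v w with hd
  have hd0 : 0 ≤ d := dist_nonneg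
  have d1 : |v.1 - w.1| ≤ d := le_max_left _ _
  have d' : dist v.2 w.2 ≤ d := le_max_right _ _
  have d2 : |v.2.1 - w.2.1| ≤ d := (le_max_left _ _).trans d'
  have d'' : dist v.2.2 w.2.2 ≤ d := (le_max_right _ _).trans d'
  have d3 : |v.2.2.1 - w.2.2.1| ≤ d := (le_max_left _ _).trans d''
  have d4 : |v.2.2.2 - w.2.2.2| ≤ d := (le_max_right _ _).trans d''
  have hA : 0 < 6 / c ^ 3 := by positivity
  have hB : 0 < 6 / c' ^ 3 := by positivity
  set A := 6 / c ^ 3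
  set B := 6 / c' ^ 3
  have hAd : 0 ≤ A * d := by positivity
  have hBd : 0 ≤ B * d := by positivity
  have f1 := abs_cutForce_sub_le hc (v.1 + μ) v.2.1 (w.1 + μ) w.2.1
  have f2 := abs_cutForce_sub_le hc v.2.1 (v.1 + μ) w.2.1 (w.1 + μ)
  have f3 := abs_cutForce_sub_le hc' (v.1 - (1 - μ)) v.2.1 (w.1 - (1 - μ)) w.2.1
  have f4 := abs_cutForce_sub_le hc' v.2.1 (v.1 - (1 - μ)) w.2.1 (w.1 - (1 - μ))
  rw [add_sub_add_right_eq_sub] at f1 f2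
  rw [sub_sub_sub_cancel_right] at f3 f4
  have hs : |v.1 - w.1| + |v.2.1 - w.2.1| ≤ 2 * d := by linarith
  have hs' : |v.2.1 - w.2.1| + |v.1 - w.1| ≤ 2 * d := by linarith
  replace f1 := abs_le.1 (f1.trans (mul_le_mul_of_nonneg_left hs hA.le))
  replace f2 := abs_le.1 (f2.trans (mul_le_mul_of_nonneg_left hs' hA.le))
  replace f3 := abs_le.1 (f3.trans (mul_le_mul_of_nonneg_left hs hB.le))
  replace f4 := abs_le.1 (f4.trans (mul_le_mul_of_nonneg_left hs' hB.le))
  rw [abs_le] at d1 d2 d3 d4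
  have comb : ∀ {F G : ℝ}, (-(A * (2 * d)) ≤ F ∧ F ≤ A * (2 * d)) →
      (-(B * (2 * d)) ≤ G ∧ G ≤ B * (2 * d)) →
      |(1 - μ) * F + μ * G| ≤ 2 * (A * d) + 2 * (B * d) := by
    intro F G hF hG
    rw [abs_le]
    constructor <;> nlinarith [mul_le_mul_of_nonneg_left hF.1 (sub_nonneg.2 hμ1),
      mul_le_mul_of_nonneg_left hF.2 (sub_nonneg.2 hμ1), mul_le_mul_of_nonneg_left hG.1 hμ0,
      mul_le_mul_of_nonneg_left hG.2 hμ0, mul_nonneg hμ0 hAd, mul_nonneg hμ0 hBd,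
      mul_nonneg (sub_nonneg.2 hμ1) hBd]
  have g1 := abs_le.1 (comb f1 f3)
  have g2 := abs_le.1 (comb f2 f4)
  change dist _ _ ≤ (2 + 2 * A + 2 * B) * d
  have e : (2 + 2 * A + 2 * B) * d = 2 * d + 2 * (A * d) + 2 * (B * d) := by ring
  rw [e]
  refine max_le ?_ (max_le ?_ (max_le ?_ ?_)) <;> simp only [cutField, Real.dist_eq] <;>
    rw [abs_le] <;> constructor <;> linarith

/-! ### Elementary calculus -/

lemma mul_sub_le_of_le_deriv {f f' : ℝ → ℝ} {a b c : ℝ} (hab : a ≤ b)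
    (hf : ∀ t ∈ Set.Icc a b, HasDerivAt f (f' t) t) (hc : ∀ t ∈ Set.Icc a b, c ≤ f' t) :
    c * (b - a) ≤ f b - f a := by
  refine (convex_Icc a b).mul_sub_le_image_sub_of_le_deriv
    (fun t ht => (hf t ht).continuousAt.continuousWithinAt)
    (fun t ht => ((hf t (interior_subset ht)).differentiableAt).differentiableWithinAt)
    (fun t ht => ?_) a ⟨le_rfl, hab⟩ b ⟨hab, le_rfl⟩ hab
  rw [(hf t (interior_subset ht)).deriv]
  exact hc t (interior_subset ht)

lemma sub_le_mul_of_deriv_le {f f' : ℝ → ℝ} {a b c : ℝ} (hab : a ≤ b)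
    (hf : ∀ t ∈ Set.Icc a b, HasDerivAt f (f' t) t) (hc : ∀ t ∈ Set.Icc a b, f' t ≤ c) :
    f b - f a ≤ c * (b - a) := by
  have := mul_sub_le_of_le_deriv (f := fun t => -f t) (f' := fun t => -f' t) (c := -c) hab
    (fun t ht => (hf t ht).neg) (fun t ht => neg_le_neg (hc t ht))
  linarith

lemma abs_sub_le_mul_of_abs_deriv_le {f f' : ℝ → ℝ} {a b c : ℝ} (hab : a ≤ b)
    (hf : ∀ t ∈ Set.Icc a b, HasDerivAt f (f' t) t) (hc : ∀ t ∈ Set.Icc a b, |f' t| ≤ c) :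
    |f b - f a| ≤ c * (b - a) := by
  rw [abs_le]
  constructor
  · have := mul_sub_le_of_le_deriv hab hf (fun t ht => (abs_le.1 (hc t ht)).1)
    linarith
  · exact sub_le_mul_of_deriv_le hab hf (fun t ht => (abs_le.1 (hc t ht)).2)

/-- Continuous induction: a continuous function which is positive at every time up to which it has
been nonnegative remains positive. -/
lemma pos_of_forall_nonneg_imp_pos {g : ℝ → ℝ} {a b : ℝ} (hg : ContinuousOn g (Set.Icc a b))
    (ha : 0 < g a)
    (h : ∀ t ∈ Set.Icc a b, (∀ s ∈ Set.Icc a t, 0 ≤ g s) → 0 < g t) :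
    ∀ t ∈ Set.Icc a b, 0 < g t := by
  by_contra! hcon
  obtain ⟨t, ht, hgt⟩ := hcon
  have hclosed : IsClosed (Set.Icc a b ∩ g ⁻¹' Set.Iic 0) :=
    hg.preimage_isClosed_of_isClosed isClosed_Icc isClosed_Iic
  set S := Set.Icc a b ∩ g ⁻¹' Set.Iic 0 with hS
  have hbdd : BddBelow S := ⟨a, fun s hs => hs.1.1⟩
  have hmem : sInf S ∈ S := hclosed.csInf_mem ⟨t, ht, hgt⟩ hbdd
  set t₀ := sInf S
  have hat : a < t₀ := by
    refine lt_of_le_of_ne hmem.1.1 fun he => ?_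
    have : g t₀ ≤ 0 := hmem.2
    rw [← he] at this
    exact absurd this (not_le.2 ha)
  have hbefore : ∀ s ∈ Set.Ico a t₀, 0 ≤ g s := by
    intro s hs
    by_contra! hneg
    exact absurd (csInf_le hbdd (show s ∈ S from ⟨⟨hs.1, hs.2.le.trans hmem.1.2⟩, hneg.le⟩))
      (not_le.2 hs.2)
  have hcont : ContinuousOn g (Set.Icc a t₀) := hg.mono (Set.Icc_subset_Icc_right hmem.1.2)
  have hall : ∀ s ∈ Set.Icc a t₀, 0 ≤ g s := by
    have hc := closure_Ico (a := a) (b := t₀) hat.ne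
    intro s hs
    have hcl : ContinuousOn g (closure (Set.Ico a t₀)) := by rwa [hc]
    exact le_on_closure (f := fun _ => (0 : ℝ)) (g := g) hbefore continuousOn_const hcl (by rwa [hc])
  exact absurd (h t₀ hmem.1 hall) (not_lt.2 hmem.2)

/-! ### Derivatives along solutions -/

lemma dS_sq (μ x y : ℝ) : dS μ x y ^ 2 = (x + μ) ^ 2 + y ^ 2 := Real.sq_sqrt (by positivity)

lemma dJ_sq (μ x y : ℝ) : dJ μ x y ^ 2 = (x - (1 - μ)) ^ 2 + y ^ 2 := Real.sq_sqrt (by positivity)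

lemma dS_nonneg (μ x y : ℝ) : 0 ≤ dS μ x y := Real.sqrt_nonneg _

lemma dJ_nonneg (μ x y : ℝ) : 0 ≤ dJ μ x y := Real.sqrt_nonneg _

/-- The Jacobi constant, i.e. the Hamiltonian of the problem. -/
noncomputable def jacobi (μ x y px py : ℝ) : ℝ :=
  (px ^ 2 + py ^ 2) / 2 - x * py + y * px - (1 - μ) / dS μ x y - μ / dJ μ x y

section Derivatives

variable {μ : ℝ} {I : Set ℝ} {q1 q2 p1 p2 : ℝ → ℝ} {t : ℝ}

lemma IsPCRTBPSol.dS_pos (h : IsPCRTBPSol μ I q1 q2 p1 p2) (ht : t ∈ I) :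
    0 < dS μ (q1 t) (q2 t) := by
  refine Real.sqrt_pos.2 ?_
  by_contra! hle
  refine (h t ht).1.1 ?_
  have h1 : q1 t + μ = 0 := by nlinarith [sq_nonneg (q1 t + μ), sq_nonneg (q2 t)]
  have h2 : q2 t = 0 := by nlinarith [sq_nonneg (q1 t + μ), sq_nonneg (q2 t)]
  rw [Prod.mk.injEq]
  exact ⟨by linarith, h2⟩

lemma IsPCRTBPSol.dJ_pos (h : IsPCRTBPSol μ I q1 q2 p1 p2) (ht : t ∈ I) :
    0 < dJ μ (q1 t) (q2 t) := by
  refine Real.sqrt_pos.2 ?_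
  by_contra! hle
  refine (h t ht).1.2 ?_
  have h1 : q1 t - (1 - μ) = 0 := by nlinarith [sq_nonneg (q1 t - (1 - μ)), sq_nonneg (q2 t)]
  have h2 : q2 t = 0 := by nlinarith [sq_nonneg (q1 t - (1 - μ)), sq_nonneg (q2 t)]
  rw [Prod.mk.injEq]
  exact ⟨by linarith, h2⟩

lemma IsPCRTBPSol.mono {J : Set ℝ} (h : IsPCRTBPSol μ I q1 q2 p1 p2) (hJ : J ⊆ I) :
    IsPCRTBPSol μ J q1 q2 p1 p2 := fun s hs => h s (hJ hs)

lemma IsPCRTBPSol.hasDerivAt_dS (h : IsPCRTBPSol μ I q1 q2 p1 p2) (ht : t ∈ I) :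
    HasDerivAt (fun s => dS μ (q1 s) (q2 s))
      (((q1 t + μ) * p1 t + q2 t * (p2 t + μ)) / dS μ (q1 t) (q2 t)) t := by
  obtain ⟨-, h1, h2, -, -⟩ := h t ht
  have hpos := h.dS_pos ht
  have hne : (q1 t + μ) ^ 2 + q2 t ^ 2 ≠ 0 := (Real.sqrt_pos.1 hpos).ne'
  have := (((h1.add_const μ).pow 2).add (h2.pow 2)).sqrt hne
  refine HasDerivAt.congr_deriv this ?_
  change _ / (2 * dS μ (q1 t) (q2 t)) = _
  rw [div_eq_div_iff (by positivity) hpos.ne']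
  simp only [Nat.cast_ofNat, Nat.add_one_sub_one, pow_one]
  ring

lemma IsPCRTBPSol.hasDerivAt_dJ (h : IsPCRTBPSol μ I q1 q2 p1 p2) (ht : t ∈ I) :
    HasDerivAt (fun s => dJ μ (q1 s) (q2 s))
      (((q1 t - (1 - μ)) * p1 t + q2 t * (p2 t - (1 - μ))) / dJ μ (q1 t) (q2 t)) t := by
  obtain ⟨-, h1, h2, -, -⟩ := h t ht
  have hpos := h.dJ_pos ht
  have hne : (q1 t - (1 - μ)) ^ 2 + q2 t ^ 2 ≠ 0 := (Real.sqrt_pos.1 hpos).ne'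
  have := (((h1.sub_const (1 - μ)).pow 2).add (h2.pow 2)).sqrt hne
  refine HasDerivAt.congr_deriv this ?_
  change _ / (2 * dJ μ (q1 t) (q2 t)) = _
  rw [div_eq_div_iff (by positivity) hpos.ne']
  simp only [Nat.cast_ofNat, Nat.add_one_sub_one, pow_one]
  ring

lemma IsPCRTBPSol.hasDerivAt_jacobi (h : IsPCRTBPSol μ I q1 q2 p1 p2) (ht : t ∈ I) :
    HasDerivAt (fun s => jacobi μ (q1 s) (q2 s) (p1 s) (p2 s)) 0 t := by
  have hS := h.hasDerivAt_dS ht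
  have hJ := h.hasDerivAt_dJ ht
  have hSp := h.dS_pos ht
  have hJp := h.dJ_pos ht
  obtain ⟨-, h1, h2, h3, h4⟩ := h t ht
  have := (((((h3.pow 2).add (h4.pow 2)).div_const 2).sub (h1.mul h4)).add (h2.mul h3)).sub
    ((hasDerivAt_const t (1 - μ)).div hS hSp.ne') |>.sub
    ((hasDerivAt_const t μ).div hJ hJp.ne')
  refine HasDerivAt.congr_deriv this ?_
  simp only [Nat.cast_ofNat, Nat.add_one_sub_one, pow_one]
  field_simp
  ring

lemma IsPCRTBPSol.jacobi_eq {a b : ℝ} (h : IsPCRTBPSol μ (Set.Icc a b) q1 q2 p1 p2)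
    (hab : a ≤ b) :
    jacobi μ (q1 b) (q2 b) (p1 b) (p2 b) = jacobi μ (q1 a) (q2 a) (p1 a) (p2 a) := by
  have := abs_sub_le_mul_of_abs_deriv_le (c := 0) hab (fun t ht => h.hasDerivAt_jacobi ht)
    (fun t ht => by simp)
  rw [zero_mul] at this
  exact sub_eq_zero.1 (abs_nonpos_iff.1 this)

/-- Angular momentum with respect to the first primary. -/
lemma IsPCRTBPSol.hasDerivAt_relAngMom (h : IsPCRTBPSol μ I q1 q2 p1 p2) (ht : t ∈ I) :
    HasDerivAt (fun s => (q1 s + μ) * (p2 s + μ) - q2 s * p1 s)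
      (μ * q2 t * (1 - 1 / dJ μ (q1 t) (q2 t) ^ 3)) t := by
  obtain ⟨-, h1, h2, h3, h4⟩ := h t ht
  refine HasDerivAt.congr_deriv (((h1.add_const μ).mul (h4.add_const μ)).sub (h2.mul h3)) ?_
  ring

/-- The virial `z ⋅ w` with respect to the first primary. -/
lemma IsPCRTBPSol.hasDerivAt_relVirial (h : IsPCRTBPSol μ I q1 q2 p1 p2) (ht : t ∈ I) :
    HasDerivAt (fun s => (q1 s + μ) * p1 s + q2 s * (p2 s + μ))
      (p1 t ^ 2 + (p2 t + μ) ^ 2 - (1 - μ) / dS μ (q1 t) (q2 t)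
        - μ * ((q1 t + μ) + ((q1 t + μ) * (q1 t - (1 - μ)) + q2 t ^ 2)
          / dJ μ (q1 t) (q2 t) ^ 3)) t := by
  have hSp := h.dS_pos ht
  obtain ⟨-, h1, h2, h3, h4⟩ := h t ht
  refine HasDerivAt.congr_deriv (((h1.add_const μ).mul h3).add (h2.mul (h4.add_const μ))) ?_
  have e : (1 - μ) / dS μ (q1 t) (q2 t)
      = (1 - μ) * ((q1 t + μ) ^ 2 + q2 t ^ 2) / dS μ (q1 t) (q2 t) ^ 3 := by
    rw [← dS_sq]; field_simp
  rw [e]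
  ring

/-- First component of the Laplace–Runge–Lenz vector with respect to the first primary. -/
lemma IsPCRTBPSol.hasDerivAt_lenz1 (h : IsPCRTBPSol μ I q1 q2 p1 p2) (ht : t ∈ I) :
    HasDerivAt (fun s => (p2 s + μ) * ((q1 s + μ) * (p2 s + μ) - q2 s * p1 s)
        - (1 - μ) * (q1 s + μ) / dS μ (q1 s) (q2 s))
      ((-p1 t * ((q1 t + μ) * (p2 t + μ) - q2 t * p1 t)
        - (1 - μ) * q2 t / dS μ (q1 t) (q2 t))
        + (-(μ * q2 t / dJ μ (q1 t) (q2 t) ^ 3)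
            * ((q1 t + μ) * (p2 t + μ) - q2 t * p1 t)
          + (p2 t + μ) * (μ * q2 t * (1 - 1 / dJ μ (q1 t) (q2 t) ^ 3)))) t := by
  have hL := h.hasDerivAt_relAngMom ht
  have hS := h.hasDerivAt_dS ht
  have hSp := h.dS_pos ht
  have hsq := dS_sq μ (q1 t) (q2 t)
  obtain ⟨-, h1, h2, h3, h4⟩ := h t ht
  refine HasDerivAt.congr_deriv
    (((h4.add_const μ).mul hL).sub (((h1.add_const μ).const_mul (1 - μ)).div hS hSp.ne')) ?_
  set ρ := dS μ (q1 t) (q2 t)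
  have hne : ρ ≠ 0 := hSp.ne'
  have e : (1 - μ) * (((q1 t + μ) * ((q1 t + μ) * p1 t + q2 t * (p2 t + μ))
      - q2 t * ((q1 t + μ) * (p2 t + μ) - q2 t * p1 t)) / ρ ^ 3 - p1 t / ρ) = 0 := by
    field_simp
    linear_combination (-(1 - μ) * p1 t) * hsq
  have e' : ∀ a b G : ℝ, (a * ρ - b * (G / ρ)) / ρ ^ 2 = a / ρ - b * G / ρ ^ 3 := by
    intro a b G
    field_simp
  rw [e']
  linear_combination e

/-- Second component of the Laplace–Runge–Lenz vector with respect to the first primary. -/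
lemma IsPCRTBPSol.hasDerivAt_lenz2 (h : IsPCRTBPSol μ I q1 q2 p1 p2) (ht : t ∈ I) :
    HasDerivAt (fun s => -p1 s * ((q1 s + μ) * (p2 s + μ) - q2 s * p1 s)
        - (1 - μ) * q2 s / dS μ (q1 s) (q2 s))
      (-((p2 t + μ) * ((q1 t + μ) * (p2 t + μ) - q2 t * p1 t)
        - (1 - μ) * (q1 t + μ) / dS μ (q1 t) (q2 t))
        + ((μ + μ * (q1 t - (1 - μ)) / dJ μ (q1 t) (q2 t) ^ 3)
            * ((q1 t + μ) * (p2 t + μ) - q2 t * p1 t)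
          - p1 t * (μ * q2 t * (1 - 1 / dJ μ (q1 t) (q2 t) ^ 3)))) t := by
  have hL := h.hasDerivAt_relAngMom ht
  have hS := h.hasDerivAt_dS ht
  have hSp := h.dS_pos ht
  have hJp := h.dJ_pos ht
  have hsq := dS_sq μ (q1 t) (q2 t)
  obtain ⟨-, h1, h2, h3, h4⟩ := h t ht
  refine HasDerivAt.congr_deriv
    ((h3.neg.mul hL).sub ((h2.const_mul (1 - μ)).div hS hSp.ne')) ?_
  simp only [Pi.neg_apply]
  set ρ := dS μ (q1 t) (q2 t)
  have hne : ρ ≠ 0 := hSp.ne'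
  have e : (1 - μ) * ((q2 t * ((q1 t + μ) * p1 t + q2 t * (p2 t + μ))
      + (q1 t + μ) * ((q1 t + μ) * (p2 t + μ) - q2 t * p1 t)) / ρ ^ 3 - (p2 t + μ) / ρ) = 0 := by
    field_simp
    linear_combination (-(1 - μ) * (p2 t + μ)) * hsq
  have e' : ∀ a b G : ℝ, (a * ρ - b * (G / ρ)) / ρ ^ 2 = a / ρ - b * G / ρ ^ 3 := by
    intro a b G
    field_simp
  rw [e']
  linear_combination e

end Derivatives


/-! ### Ejection from the first primary -/

/-- A curve which leaves perpendicularly from the axis at distance `δ` of the first primary, with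
Kepler energy `κ`. -/
structure Launch (μ δ κ v : ℝ) (q1 q2 p1 p2 : ℝ → ℝ) : Prop where
  mass_pos : 0 < μ
  mass_lt : μ < 1 / 10 ^ 9
  dist_pos : 0 < δ
  dist_le : δ ≤ μ ^ 2 / 4
  abs_energy_le : |κ| ≤ 1 / 10
  speed_pos : 0 < v
  speed_sq : v ^ 2 * δ = 2 * (1 - μ) + 2 * κ * δ
  q1_zero : q1 0 = δ - μ
  q2_zero : q2 0 = 0
  p1_zero : p1 0 = 0
  p2_zero : p2 0 = v - μ

/-- A launched solution on `[0, T]` which stays in the disc of radius `3/2` about the first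
primary, away from the second primary. -/
structure Ejection (μ δ κ v T : ℝ) (q1 q2 p1 p2 : ℝ → ℝ) : Prop
    extends Launch μ δ κ v q1 q2 p1 p2 where
  time_nonneg : 0 ≤ T
  time_le : T ≤ 3
  sol : IsPCRTBPSol μ (Set.Icc 0 T) q1 q2 p1 p2
  le_dJ : ∀ t ∈ Set.Icc 0 T, 1 / 10 ≤ dJ μ (q1 t) (q2 t)
  dS_le : ∀ t ∈ Set.Icc 0 T, dS μ (q1 t) (q2 t) ≤ 3 / 2

lemma abs_le_dS (μ x y : ℝ) : |x + μ| ≤ dS μ x y := Real.abs_le_sqrt (by nlinarith [sq_nonneg y])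

lemma abs_le_dS' (μ x y : ℝ) : |y| ≤ dS μ x y :=
  Real.abs_le_sqrt (by nlinarith [sq_nonneg (x + μ)])

lemma abs_le_dJ (μ x y : ℝ) : |x - (1 - μ)| ≤ dJ μ x y :=
  Real.abs_le_sqrt (by nlinarith [sq_nonneg y])

lemma abs_le_dJ' (μ x y : ℝ) : |y| ≤ dJ μ x y :=
  Real.abs_le_sqrt (by nlinarith [sq_nonneg (x - (1 - μ))])

lemma Launch.dS_zero {μ δ κ v : ℝ} {q1 q2 p1 p2 : ℝ → ℝ}
    (h : Launch μ δ κ v q1 q2 p1 p2) : dS μ (q1 0) (q2 0) = δ := by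
  rw [h.q1_zero, h.q2_zero, dS]
  have : (δ - μ + μ) ^ 2 + 0 ^ 2 = δ ^ 2 := by ring
  rw [this, Real.sqrt_sq h.dist_pos.le]

namespace Ejection

variable {μ δ κ v T : ℝ} {q1 q2 p1 p2 : ℝ → ℝ} {t : ℝ}

lemma restrict {S : ℝ} (h : Ejection μ δ κ v T q1 q2 p1 p2) (hS : S ∈ Set.Icc 0 T) :
    Ejection μ δ κ v S q1 q2 p1 p2 :=
  have hsub : Set.Icc 0 S ⊆ Set.Icc 0 T := Set.Icc_subset_Icc_right hS.2
  { h with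
    time_nonneg := hS.1
    time_le := hS.2.trans h.time_le
    sol := h.sol.mono hsub
    le_dJ := fun t ht => h.le_dJ t (hsub ht)
    dS_le := fun t ht => h.dS_le t (hsub ht) }

lemma inv_dJ_le (h : Ejection μ δ κ v T q1 q2 p1 p2) (ht : t ∈ Set.Icc 0 T) :
    1 / dJ μ (q1 t) (q2 t) ≤ 10 := by
  have := h.le_dJ t ht
  rw [div_le_iff₀ (by linarith)]
  linarith

lemma inv_dJ_pos (h : Ejection μ δ κ v T q1 q2 p1 p2) (ht : t ∈ Set.Icc 0 T) :
    0 < 1 / dJ μ (q1 t) (q2 t) := by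
  have := h.le_dJ t ht
  positivity

lemma angMom_zero_le (h : Ejection μ δ κ v T q1 q2 p1 p2) : δ * v ≤ μ := by
  have h1 := h.mass_pos
  have h2 := h.mass_lt
  have h3 := h.dist_pos
  have h4 := h.dist_le
  have h5 := abs_le.1 h.abs_energy_le
  have hδ : δ ≤ 1 := by nlinarith
  refine (sq_le_sq₀ (mul_pos h3 h.speed_pos).le h1.le).1 ?_
  have : (δ * v) ^ 2 = δ * (2 * (1 - μ) + 2 * κ * δ) := by rw [← h.speed_sq]; ring
  rw [this]
  nlinarith [mul_le_mul_of_nonneg_right h5.2 h3.le]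

lemma abs_deriv_angMom_le (h : Ejection μ δ κ v T q1 q2 p1 p2) (ht : t ∈ Set.Icc 0 T) :
    |μ * q2 t * (1 - 1 / dJ μ (q1 t) (q2 t) ^ 3)| ≤ 1500 * μ := by
  have h1 := h.mass_pos
  have hb := h.inv_dJ_le ht
  have hb0 := h.inv_dJ_pos ht
  have hq := (abs_le_dS' μ (q1 t) (q2 t)).trans (h.dS_le t ht)
  have e : 1 / dJ μ (q1 t) (q2 t) ^ 3 = (1 / dJ μ (q1 t) (q2 t)) ^ 3 := by rw [div_pow, one_pow]
  have h3 : (1 / dJ μ (q1 t) (q2 t)) ^ 3 ≤ 10 ^ 3 := pow_le_pow_left₀ hb0.le hb 3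
  have h4 : 0 < (1 / dJ μ (q1 t) (q2 t)) ^ 3 := by positivity
  have h5 : |1 - 1 / dJ μ (q1 t) (q2 t) ^ 3| ≤ 1000 := by
    rw [e, abs_le]
    constructor <;> linarith
  rw [abs_mul, abs_mul, abs_of_pos h1]
  nlinarith [mul_le_mul hq h5 (abs_nonneg _) (by norm_num : (0 : ℝ) ≤ 3 / 2)]

lemma abs_angMom_le (h : Ejection μ δ κ v T q1 q2 p1 p2) :
    |(q1 T + μ) * (p2 T + μ) - q2 T * p1 T| ≤ 1 / 10 ^ 5 := by
  have h1 := abs_sub_le_mul_of_abs_deriv_le h.time_nonneg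
    (fun t ht => h.sol.hasDerivAt_relAngMom ht) (fun t ht => h.abs_deriv_angMom_le ht)
  have h2 := h.angMom_zero_le
  have h3 := mul_pos h.dist_pos h.speed_pos
  have h4 := h.mass_lt
  have h5 := h.mass_pos
  have h6 := mul_le_mul_of_nonneg_left h.time_le h5.le
  rw [h.q1_zero, h.q2_zero, h.p2_zero] at h1
  rw [abs_le] at h1 ⊢
  constructor <;> nlinarith

/-- The Jacobi constant stays close to the initial Kepler energy. -/
lemma abs_jacobi_sub_le (h : Ejection μ δ κ v T q1 q2 p1 p2) :
    |jacobi μ (q1 0) (q2 0) (p1 0) (p2 0) - κ| ≤ 1 / 10 ^ 7 := by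
  have h1 := h.mass_pos
  have h2 := h.mass_lt
  have h3 := h.dist_pos
  have h4 := h.dist_le
  have h0 : (0 : ℝ) ∈ Set.Icc 0 T := ⟨le_rfl, h.time_nonneg⟩
  have hb := h.inv_dJ_le h0
  have hb0 := h.inv_dJ_pos h0
  have h5 := h.angMom_zero_le
  have h6 := mul_pos h3 h.speed_pos
  have e : jacobi μ (q1 0) (q2 0) (p1 0) (p2 0) - κ
      = μ * δ - δ * v - μ ^ 2 / 2 - μ * (1 / dJ μ (q1 0) (q2 0)) := by
    have : v ^ 2 / 2 - (1 - μ) / δ = κ := by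
      field_simp
      linarith [h.speed_sq]
    rw [jacobi, h.dS_zero, h.q1_zero, h.q2_zero, h.p1_zero, h.p2_zero, div_eq_mul_one_div μ]
    linear_combination this
  rw [e, abs_le]
  have h7 := mul_le_mul_of_nonneg_left hb h1.le
  have h8 := mul_pos h1 hb0
  constructor <;> nlinarith

lemma abs_energy_sub_le (h : Ejection μ δ κ v T q1 q2 p1 p2) :
    |(p1 T ^ 2 + (p2 T + μ) ^ 2) / 2 - (1 - μ) / dS μ (q1 T) (q2 T) - κ| ≤ 1 / 10 ^ 4 := by
  have h1 := h.mass_pos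
  have h2 := h.mass_lt
  have hT : T ∈ Set.Icc 0 T := ⟨h.time_nonneg, le_rfl⟩
  have hb := h.inv_dJ_le hT
  have hb0 := h.inv_dJ_pos hT
  have hq := abs_le.1 ((abs_le_dS μ (q1 T) (q2 T)).trans (h.dS_le T hT))
  have h3 := abs_le.1 h.abs_jacobi_sub_le
  have h4 := abs_le.1 h.abs_angMom_le
  rw [← h.sol.jacobi_eq h.time_nonneg, jacobi, div_eq_mul_one_div μ] at h3
  have h7 := mul_le_mul_of_nonneg_left hb h1.le
  have h8 := mul_pos h1 hb0
  have h9 := mul_le_mul_of_nonneg_left hq.1 h1.le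
  have h10 := mul_le_mul_of_nonneg_left hq.2 h1.le
  rw [abs_le]
  constructor <;> nlinarith

lemma le_deriv_virial (h : Ejection μ δ κ v T q1 q2 p1 p2) (ht : t ∈ Set.Icc 0 T) :
    46 / 100 ≤ p1 t ^ 2 + (p2 t + μ) ^ 2 - (1 - μ) / dS μ (q1 t) (q2 t)
        - μ * ((q1 t + μ) + ((q1 t + μ) * (q1 t - (1 - μ)) + q2 t ^ 2)
          / dJ μ (q1 t) (q2 t) ^ 3) := by
  have h1 := h.mass_pos
  have h2 := h.mass_lt
  have hb := h.inv_dJ_le ht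
  have hb0 := h.inv_dJ_pos ht
  have hS := h.dS_le t ht
  have hSp := h.sol.dS_pos ht
  have hJp := h.sol.dJ_pos ht
  have hκ := abs_le.1 h.abs_energy_le
  have hE := abs_le.1 (h.restrict ht).abs_energy_sub_le
  have hq1 := abs_le_dS μ (q1 t) (q2 t)
  have hq2 := abs_le_dS' μ (q1 t) (q2 t)
  have hd1 := abs_le_dJ μ (q1 t) (q2 t)
  have hd2 := abs_le_dJ' μ (q1 t) (q2 t)
  set D := dJ μ (q1 t) (q2 t)
  set ρ := dS μ (q1 t) (q2 t)
  have hm : 666 / 1000 ≤ (1 - μ) / ρ := by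
    rw [le_div_iff₀ hSp]; nlinarith
  have hdot : (q1 t + μ) * (q1 t - (1 - μ)) + q2 t ^ 2 ≤ 2 * (ρ * D) := by
    have a1 := (le_abs_self _).trans ((abs_mul (q1 t + μ) (q1 t - (1 - μ))).le.trans
      (mul_le_mul hq1 hd1 (abs_nonneg _) hSp.le))
    have a2 := (le_abs_self _).trans ((abs_mul (q2 t) (q2 t)).le.trans
      (mul_le_mul hq2 hd2 (abs_nonneg _) hSp.le))
    nlinarith
  have h3 : ((q1 t + μ) * (q1 t - (1 - μ)) + q2 t ^ 2) / D ^ 3 ≤ 300 := by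
    have e : ((q1 t + μ) * (q1 t - (1 - μ)) + q2 t ^ 2) / D ^ 3
        ≤ 2 * ρ * (1 / D) ^ 2 := by
      rw [div_le_iff₀ (by positivity)]
      calc _ ≤ 2 * (ρ * D) := hdot
        _ = _ := by field_simp
    have : (1 / D) ^ 2 ≤ 10 ^ 2 := pow_le_pow_left₀ hb0.le hb 2
    nlinarith
  have h4 : q1 t + μ ≤ 3 / 2 := (le_abs_self _).trans (hq1.trans hS)
  have h5 : μ * ((q1 t + μ) + ((q1 t + μ) * (q1 t - (1 - μ)) + q2 t ^ 2) / D ^ 3)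
      ≤ μ * 400 := mul_le_mul_of_nonneg_left (by linarith) h1.le
  linarith

lemma le_virial (h : Ejection μ δ κ v T q1 q2 p1 p2) :
    46 / 100 * T ≤ (q1 T + μ) * p1 T + q2 T * (p2 T + μ) := by
  have := mul_sub_le_of_le_deriv h.time_nonneg
    (fun t ht => h.sol.hasDerivAt_relVirial ht) (fun t ht => h.le_deriv_virial ht)
  simp only [h.q2_zero, h.p1_zero] at this
  linarith

lemma hasDerivAt_dS_sq (h : Ejection μ δ κ v T q1 q2 p1 p2) (ht : t ∈ Set.Icc 0 T) :
    HasDerivAt (fun s => dS μ (q1 s) (q2 s) ^ 2)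
      (2 * ((q1 t + μ) * p1 t + q2 t * (p2 t + μ))) t := by
  refine HasDerivAt.congr_deriv ((h.sol.hasDerivAt_dS ht).pow 2) ?_
  have := h.sol.dS_pos ht
  simp only [Nat.cast_ofNat, Nat.add_one_sub_one, pow_one]
  field_simp

lemma le_dS_sq (h : Ejection μ δ κ v T q1 q2 p1 p2) :
    δ ^ 2 + 46 / 100 * T ^ 2 ≤ dS μ (q1 T) (q2 T) ^ 2 := by
  have := mul_sub_le_of_le_deriv (c := 0) h.time_nonneg
    (fun t ht => (h.hasDerivAt_dS_sq ht).sub (((hasDerivAt_id t).pow 2).const_mul (46 / 100)))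
    (fun t ht => by
      have := (h.restrict ht).le_virial
      simp only [id, Nat.cast_ofNat, Nat.add_one_sub_one, pow_one, mul_one]
      linarith)
  simp only [id, h.dS_zero, Pi.pow_apply, Pi.sub_apply] at this
  linarith

lemma le_dS (h : Ejection μ δ κ v T q1 q2 p1 p2) : δ ≤ dS μ (q1 T) (q2 T) := by
  refine (sq_le_sq₀ h.dist_pos.le (dS_nonneg _ _ _)).1 ?_
  nlinarith [h.le_dS_sq, sq_nonneg T]

lemma le_virial_sq (h : Ejection μ δ κ v T q1 q2 p1 p2) :
    46 / 100 * (dS μ (q1 T) (q2 T) ^ 2 - δ ^ 2)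
      ≤ ((q1 T + μ) * p1 T + q2 T * (p2 T + μ)) ^ 2 := by
  have := mul_sub_le_of_le_deriv (c := 0) h.time_nonneg
    (fun t ht => ((h.sol.hasDerivAt_relVirial ht).pow 2).sub
      ((h.hasDerivAt_dS_sq ht).const_mul (46 / 100)))
    (fun t ht => by
      have h1 := (h.restrict ht).le_virial
      have h2 := h.le_deriv_virial ht
      have h3 := ht.1
      simp only [Nat.cast_ofNat, Nat.add_one_sub_one, pow_one]
      nlinarith [mul_nonneg (sub_nonneg.2 h2) (by linarith :
        0 ≤ (q1 t + μ) * p1 t + q2 t * (p2 t + μ))])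
  simp only [Pi.pow_apply, Pi.sub_apply] at this
  rw [h.dS_zero, h.q2_zero, h.p1_zero] at this
  linarith

lemma virial_nonneg (h : Ejection μ δ κ v T q1 q2 p1 p2) :
    0 ≤ (q1 T + μ) * p1 T + q2 T * (p2 T + μ) := by
  have := h.le_virial
  have := h.time_nonneg
  linarith

lemma abs_lenz_perturb_le (h : Ejection μ δ κ v T q1 q2 p1 p2) (ht : t ∈ Set.Icc 0 T) :
    |-(μ * q2 t / dJ μ (q1 t) (q2 t) ^ 3) * ((q1 t + μ) * (p2 t + μ) - q2 t * p1 t)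
        + (p2 t + μ) * (μ * q2 t * (1 - 1 / dJ μ (q1 t) (q2 t) ^ 3))| ≤ 1 / 10 ^ 5 ∧
    |(μ + μ * (q1 t - (1 - μ)) / dJ μ (q1 t) (q2 t) ^ 3)
            * ((q1 t + μ) * (p2 t + μ) - q2 t * p1 t)
          - p1 t * (μ * q2 t * (1 - 1 / dJ μ (q1 t) (q2 t) ^ 3))| ≤ 1 / 10 ^ 5 := by
  have h1 := h.mass_pos
  have h2 := h.mass_lt
  have hb := h.inv_dJ_le ht
  have hb0 := h.inv_dJ_pos ht
  have hS := h.dS_le t ht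
  have hSp := h.sol.dS_pos ht
  have hJp := h.sol.dJ_pos ht
  have hκ := abs_le.1 h.abs_energy_le
  have hE := abs_le.1 (h.restrict ht).abs_energy_sub_le
  have hℓ := (h.restrict ht).abs_angMom_le
  have hq2 := abs_le_dS' μ (q1 t) (q2 t)
  have hd1 := abs_le_dJ μ (q1 t) (q2 t)
  set D := dJ μ (q1 t) (q2 t)
  set ρ := dS μ (q1 t) (q2 t)
  set ℓ := (q1 t + μ) * (p2 t + μ) - q2 t * p1 t
  have e : 1 / D ^ 3 = (1 / D) ^ 3 := by rw [div_pow, one_pow]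
  have hb3 : 1 / D ^ 3 ≤ 10 ^ 3 := e ▸ pow_le_pow_left₀ hb0.le hb 3
  have hb3' : 0 < 1 / D ^ 3 := by positivity
  have hw : (p1 t ^ 2 + (p2 t + μ) ^ 2) * ρ ^ 2 ≤ 4 := by
    have e1 : (1 - μ) / ρ * ρ ^ 2 = (1 - μ) * ρ := by field_simp
    have e2 : (p1 t ^ 2 + (p2 t + μ) ^ 2) * ρ ^ 2 ≤ (2 * (1 - μ) / ρ + 3 / 10) * ρ ^ 2 := by
      refine mul_le_mul_of_nonneg_right ?_ (by positivity)
      rw [mul_div_assoc]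
      linarith
    nlinarith
  have hw1 : |p1 t| * ρ ≤ 2 := by
    refine (sq_le_sq₀ (by positivity) (by norm_num)).1 ?_
    rw [mul_pow, sq_abs]
    nlinarith [mul_nonneg (sq_nonneg (p2 t + μ)) (sq_nonneg ρ)]
  have hw2 : |p2 t + μ| * ρ ≤ 2 := by
    refine (sq_le_sq₀ (by positivity) (by norm_num)).1 ?_
    rw [mul_pow, sq_abs]
    nlinarith [mul_nonneg (sq_nonneg (p1 t)) (sq_nonneg ρ)]
  have hF : |1 - 1 / D ^ 3| ≤ 1000 := by
    rw [abs_le]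
    constructor <;> linarith
  have key : ∀ w : ℝ, |w| * ρ ≤ 2 → |w * (μ * q2 t * (1 - 1 / D ^ 3))| ≤ 2000 * μ := by
    intro w hw
    have a1 : |w| * |q2 t| ≤ 2 := (mul_le_mul_of_nonneg_left hq2 (abs_nonneg w)).trans hw
    have a2 := mul_le_mul a1 hF (abs_nonneg _) (by norm_num)
    rw [abs_mul, abs_mul, abs_mul, abs_of_pos h1]
    nlinarith
  have k1 := key _ hw1
  have k2 := key _ hw2
  have l1 : |-(μ * q2 t / D ^ 3) * ℓ| ≤ 2000 * μ := by
    rw [div_eq_mul_one_div (μ * q2 t), abs_mul, abs_neg, abs_mul, abs_mul, abs_of_pos h1,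
      abs_of_pos hb3']
    have a1 := mul_le_mul (hq2.trans hS) hb3 hb3'.le (by norm_num)
    have a2 := mul_le_mul a1 hℓ (abs_nonneg _) (by norm_num)
    nlinarith
  have l2 : |(μ + μ * (q1 t - (1 - μ)) / D ^ 3) * ℓ| ≤ 200 * μ := by
    have a0 : |(q1 t - (1 - μ)) / D ^ 3| ≤ 100 := by
      rw [abs_div, abs_of_pos (by positivity : 0 < D ^ 3), div_le_iff₀ (by positivity)]
      refine hd1.trans ?_
      have := pow_le_pow_left₀ (by norm_num) (h.le_dJ t ht) 2
      change _ ≤ D ^ 2 at this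
      nlinarith
    have a1 : |1 + (q1 t - (1 - μ)) / D ^ 3| ≤ 101 := by
      have := abs_le.1 a0
      rw [abs_le]
      constructor <;> linarith
    have a2 := mul_le_mul a1 hℓ (abs_nonneg _) (by norm_num)
    have e3 : (μ + μ * (q1 t - (1 - μ)) / D ^ 3) * ℓ
        = μ * ((1 + (q1 t - (1 - μ)) / D ^ 3) * ℓ) := by ring
    rw [e3, abs_mul, abs_of_pos h1, abs_mul]
    nlinarith
  exact ⟨(abs_add_le _ _).trans (by linarith), (abs_sub _ _).trans (by linarith)⟩

/-- The square of the norm of the Laplace–Runge–Lenz vector. -/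
lemma lenz_sq_le (h : Ejection μ δ κ v T q1 q2 p1 p2) :
    ((p2 T + μ) * ((q1 T + μ) * (p2 T + μ) - q2 T * p1 T)
        - (1 - μ) * (q1 T + μ) / dS μ (q1 T) (q2 T)) ^ 2
      + (-p1 T * ((q1 T + μ) * (p2 T + μ) - q2 T * p1 T)
        - (1 - μ) * q2 T / dS μ (q1 T) (q2 T)) ^ 2 ≤ 1.01 ^ 2 := by
  have hT : T ∈ Set.Icc 0 T := ⟨h.time_nonneg, le_rfl⟩
  have h1 := h.mass_pos
  have h2 := h.mass_lt
  have hκ := abs_le.1 h.abs_energy_le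
  have hE := abs_le.1 h.abs_energy_sub_le
  have hℓ := abs_le.1 h.abs_angMom_le
  have hSp := h.sol.dS_pos hT
  have hsq := dS_sq μ (q1 T) (q2 T)
  set ρ := dS μ (q1 T) (q2 T)
  set K := (p1 T ^ 2 + (p2 T + μ) ^ 2) / 2 - (1 - μ) / ρ with hK
  set ℓ := (q1 T + μ) * (p2 T + μ) - q2 T * p1 T with hl
  have e : ((p2 T + μ) * ℓ - (1 - μ) * (q1 T + μ) / ρ) ^ 2
      + (-p1 T * ℓ - (1 - μ) * q2 T / ρ) ^ 2 = (1 - μ) ^ 2 + 2 * K * ℓ ^ 2 := by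
    have e1 : ((q1 T + μ) ^ 2 + q2 T ^ 2) / ρ ^ 2 = 1 := by
      rw [← hsq]; field_simp
    linear_combination (1 - μ) ^ 2 * e1 - 2 * ℓ ^ 2 * hK + 2 * (1 - μ) / ρ * ℓ * hl
  have : ℓ ^ 2 ≤ 1 / 10 ^ 5 := by nlinarith
  rw [e]
  nlinarith [sq_nonneg ℓ]

lemma le_lenz2 (h : Ejection μ δ κ v T q1 q2 p1 p2) :
    -1.02 * T ≤ -p1 T * ((q1 T + μ) * (p2 T + μ) - q2 T * p1 T)
        - (1 - μ) * q2 T / dS μ (q1 T) (q2 T) := by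
  have := mul_sub_le_of_le_deriv (c := -1.02) h.time_nonneg
    (fun t ht => h.sol.hasDerivAt_lenz2 ht) (fun t ht => by
      have a1 := abs_le.1 (h.abs_lenz_perturb_le ht).2
      have a2 := (h.restrict ht).lenz_sq_le
      have a3 := abs_le_of_sq_le_sq' (le_trans (le_add_of_nonneg_right (sq_nonneg _)) a2)
        (by norm_num)
      linarith)
  rw [h.q2_zero, h.p1_zero] at this
  simp only [neg_zero, zero_mul, mul_zero, zero_div, sub_zero] at this
  exact this

lemma le_lenz1 (h : Ejection μ δ κ v T q1 q2 p1 p2) :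
    0.98 - 0.51 * T ^ 2 ≤ (p2 T + μ) * ((q1 T + μ) * (p2 T + μ) - q2 T * p1 T)
        - (1 - μ) * (q1 T + μ) / dS μ (q1 T) (q2 T) := by
  have := mul_sub_le_of_le_deriv (c := -(1 / 10 ^ 5)) h.time_nonneg
    (fun t ht => (h.sol.hasDerivAt_lenz1 ht).add (((hasDerivAt_id t).pow 2).const_mul 0.51))
    (fun t ht => by
      have a1 := abs_le.1 (h.abs_lenz_perturb_le ht).1
      have a2 := (h.restrict ht).le_lenz2
      simp only [id, Nat.cast_ofNat, Nat.add_one_sub_one, pow_one, mul_one]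
      linarith)
  have h1 := h.mass_pos
  have h2 := h.mass_lt
  have h3 := h.dist_pos
  have h4 := h.dist_le
  have hκ := abs_le.1 h.abs_energy_le
  have hT := h.time_le
  have e : δ * v * v = 2 * (1 - μ) + 2 * κ * δ := by rw [← h.speed_sq]; ring
  have e' : (1 - μ) * δ / δ = 1 - μ := by field_simp
  simp only [id, Pi.add_apply, Pi.pow_apply] at this
  rw [h.dS_zero, h.q2_zero, h.p1_zero, h.q1_zero, h.p2_zero, sub_add_cancel, sub_add_cancel,
    e'] at this
  nlinarith

/-- An ejection orbit does not come close to the second primary. -/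
lemma lt_dJ (h : Ejection μ δ κ v T q1 q2 p1 p2) : 1 / 10 < dJ μ (q1 T) (q2 T) := by
  by_contra! hle
  have hT : T ∈ Set.Icc 0 T := ⟨h.time_nonneg, le_rfl⟩
  have h1 := h.mass_pos
  have h2 := h.mass_lt
  have hSp := h.sol.dS_pos hT
  have hsq := dS_sq μ (q1 T) (q2 T)
  have hd1 := abs_le.1 ((abs_le_dJ μ (q1 T) (q2 T)).trans hle)
  have hd2 := abs_le.1 ((abs_le_dJ' μ (q1 T) (q2 T)).trans hle)
  have hJ := dJ_sq μ (q1 T) (q2 T)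
  have hℓ := abs_le.1 h.abs_angMom_le
  have hA1 := h.le_lenz1
  have hA := h.lenz_sq_le
  have hgrow := h.le_dS_sq
  have hρ := (le_abs_self _).trans (abs_le_dS μ (q1 T) (q2 T))
  have hJ0 := dJ_nonneg μ (q1 T) (q2 T)
  set ρ := dS μ (q1 T) (q2 T)
  set ℓ := (q1 T + μ) * (p2 T + μ) - q2 T * p1 T with hl
  set A1 := (p2 T + μ) * ℓ - (1 - μ) * (q1 T + μ) / ρ with hA1d
  set A2 := -p1 T * ℓ - (1 - μ) * q2 T / ρ with hA2d
  have e : (q1 T + μ) * A1 + q2 T * A2 = ℓ ^ 2 - (1 - μ) * ρ := by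
    have e1 : ((q1 T + μ) ^ 2 + q2 T ^ 2) / ρ = ρ := by
      rw [← hsq]; field_simp
    rw [hA1d, hA2d]
    linear_combination (-(1 - μ)) * e1 - ℓ * hl
  clear_value A1 A2 ρ ℓ
  have hz : q1 T + μ ≤ 1.1 := by linarith
  have hz' : 0.9 ≤ q1 T + μ := by linarith
  have hρsq : ρ ^ 2 ≤ 1.22 := by
    have a1 : (q1 T + μ) ^ 2 ≤ 1.1 ^ 2 := pow_le_pow_left₀ (by linarith) hz 2
    have a2 : q2 T ^ 2 ≤ 0.1 ^ 2 := sq_le_sq' (by linarith) (by linarith)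
    rw [hsq]
    linarith
  have hA1' : -0.4 ≤ A1 := by linarith [sq_nonneg δ]
  have hA2sq : A2 ^ 2 ≤ 1.01 ^ 2 := by linarith [sq_nonneg A1]
  have hA2' := abs_le_of_sq_le_sq hA2sq (by norm_num)
  have b1 : -0.44 ≤ (q1 T + μ) * A1 := by
    linarith [mul_le_mul_of_nonneg_left hA1' (by linarith : 0 ≤ q1 T + μ)]
  have b2 : |q2 T * A2| ≤ 0.1 * 1.01 := by
    rw [abs_mul]
    exact mul_le_mul (abs_le.2 ⟨by linarith, by linarith⟩) hA2' (abs_nonneg _) (by norm_num)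
  have b3 := (abs_le.1 b2).1
  have b4 : ℓ ^ 2 ≤ (1 / 10 ^ 5) ^ 2 := sq_le_sq' hℓ.1 hℓ.2
  have b5 : (1 - 1 / 10 ^ 9) * 0.9 ≤ (1 - μ) * ρ :=
    mul_le_mul (by linarith) (by linarith) (by norm_num) (by linarith)
  norm_num at b4 b5 b3
  linarith

end Ejection

/-! ### Solutions of the truncated problem -/

/-- Solutions of the problem with the force of the first primary truncated at distance `c` and that
of the second primary truncated at distance `1/10`. -/
structure IsCutSol (μ c : ℝ) (q1 q2 p1 p2 : ℝ → ℝ) : Prop where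
  hasDerivAt_q1 : ∀ t, HasDerivAt q1 (p1 t + q2 t) t
  hasDerivAt_q2 : ∀ t, HasDerivAt q2 (p2 t - q1 t) t
  hasDerivAt_p1 : ∀ t, HasDerivAt p1 (p2 t - (1 - μ) * cutForce c (q1 t + μ) (q2 t)
    - μ * cutForce (1 / 10) (q1 t - (1 - μ)) (q2 t)) t
  hasDerivAt_p2 : ∀ t, HasDerivAt p2 (-p1 t - (1 - μ) * cutForce c (q2 t) (q1 t + μ)
    - μ * cutForce (1 / 10) (q2 t) (q1 t - (1 - μ))) t

lemma isCutSol_of_hasDerivAt {μ c : ℝ} {φ : ℝ → ℝ × ℝ × ℝ × ℝ}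
    (h : ∀ t, HasDerivAt φ (cutField μ c (1 / 10) (φ t)) t) :
    IsCutSol μ c (fun t => (φ t).1) (fun t => (φ t).2.1) (fun t => (φ t).2.2.1)
      (fun t => (φ t).2.2.2) where
  hasDerivAt_q1 t := (hasFDerivAt_fst.comp_hasDerivAt t (h t) :)
  hasDerivAt_q2 t := (hasFDerivAt_fst.comp_hasDerivAt t (hasFDerivAt_snd.comp_hasDerivAt t (h t)) :)
  hasDerivAt_p1 t := (hasFDerivAt_fst.comp_hasDerivAt t (hasFDerivAt_snd.comp_hasDerivAt t
    (hasFDerivAt_snd.comp_hasDerivAt t (h t))) :)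
  hasDerivAt_p2 t := (hasFDerivAt_snd.comp_hasDerivAt t (hasFDerivAt_snd.comp_hasDerivAt t
    (hasFDerivAt_snd.comp_hasDerivAt t (h t))) :)

lemma cutForce_eq_dS {μ c x y : ℝ} (h : c ≤ dS μ x y) :
    cutForce c (x + μ) y = (x + μ) / dS μ x y ^ 3 ∧
      cutForce c y (x + μ) = y / dS μ x y ^ 3 := by
  rw [cutForce, cutForce, add_comm (y ^ 2)]
  exact ⟨by rw [max_eq_left (show c ≤ √((x + μ) ^ 2 + y ^ 2) from h)]; rfl,
    by rw [max_eq_left (show c ≤ √((x + μ) ^ 2 + y ^ 2) from h)]; rfl⟩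

lemma cutForce_eq_dJ {μ c x y : ℝ} (h : c ≤ dJ μ x y) :
    cutForce c (x - (1 - μ)) y = (x - (1 - μ)) / dJ μ x y ^ 3 ∧
      cutForce c y (x - (1 - μ)) = y / dJ μ x y ^ 3 := by
  rw [cutForce, cutForce, add_comm (y ^ 2)]
  exact ⟨by rw [max_eq_left (show c ≤ √((x - (1 - μ)) ^ 2 + y ^ 2) from h)]; rfl,
    by rw [max_eq_left (show c ≤ √((x - (1 - μ)) ^ 2 + y ^ 2) from h)]; rfl⟩

namespace IsCutSol

variable {μ c : ℝ} {q1 q2 p1 p2 : ℝ → ℝ}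

lemma isPCRTBPSol {I : Set ℝ} (h : IsCutSol μ c q1 q2 p1 p2) (hc : 0 < c)
    (hS : ∀ t ∈ I, c ≤ dS μ (q1 t) (q2 t)) (hJ : ∀ t ∈ I, 1 / 10 ≤ dJ μ (q1 t) (q2 t)) :
    IsPCRTBPSol μ I q1 q2 p1 p2 := by
  intro t ht
  have s := cutForce_eq_dS (hS t ht)
  have j := cutForce_eq_dJ (hJ t ht)
  refine ⟨⟨fun e => ?_, fun e => ?_⟩, h.hasDerivAt_q1 t, h.hasDerivAt_q2 t, ?_, ?_⟩
  · have := hS t ht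
    rw [Prod.mk.injEq] at e
    rw [e.1, e.2, dS] at this
    norm_num at this
    linarith
  · have := hJ t ht
    rw [Prod.mk.injEq] at e
    rw [e.1, e.2, dJ] at this
    norm_num at this
  · have := h.hasDerivAt_p1 t
    rwa [s.1, j.1, ← mul_div_assoc, ← mul_div_assoc] at this
  · have := h.hasDerivAt_p2 t
    rwa [s.2, j.2, ← mul_div_assoc, ← mul_div_assoc] at this

lemma continuous_q1 (h : IsCutSol μ c q1 q2 p1 p2) : Continuous q1 :=
  continuous_iff_continuousAt.2 fun t => (h.hasDerivAt_q1 t).continuousAt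

lemma continuous_q2 (h : IsCutSol μ c q1 q2 p1 p2) : Continuous q2 :=
  continuous_iff_continuousAt.2 fun t => (h.hasDerivAt_q2 t).continuousAt

lemma continuous_p1 (h : IsCutSol μ c q1 q2 p1 p2) : Continuous p1 :=
  continuous_iff_continuousAt.2 fun t => (h.hasDerivAt_p1 t).continuousAt

lemma continuous_p2 (h : IsCutSol μ c q1 q2 p1 p2) : Continuous p2 :=
  continuous_iff_continuousAt.2 fun t => (h.hasDerivAt_p2 t).continuousAt

lemma continuous_dS (h : IsCutSol μ c q1 q2 p1 p2) : Continuous fun t => dS μ (q1 t) (q2 t) := by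
  have := h.continuous_q1
  have := h.continuous_q2
  unfold dS
  fun_prop

lemma continuous_dJ (h : IsCutSol μ c q1 q2 p1 p2) : Continuous fun t => dJ μ (q1 t) (q2 t) := by
  have := h.continuous_q1
  have := h.continuous_q2
  unfold dJ
  fun_prop

variable {δ κ v : ℝ}

lemma ejection {T : ℝ} (hs : IsCutSol μ (δ / 2) q1 q2 p1 p2) (h : Launch μ δ κ v q1 q2 p1 p2)
    (hT0 : 0 ≤ T) (hT : T ≤ 3) (hS : ∀ t ∈ Set.Icc 0 T, dS μ (q1 t) (q2 t) ≤ 3 / 2) :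
    Ejection μ δ κ v T q1 q2 p1 p2 := by
  have hδ := h.dist_pos
  have key : ∀ t ∈ Set.Icc 0 T, (∀ s ∈ Set.Icc 0 t,
      0 ≤ min (dS μ (q1 s) (q2 s) - δ / 2) (dJ μ (q1 s) (q2 s) - 1 / 10)) →
      Ejection μ δ κ v t q1 q2 p1 p2 := by
    intro t ht hst
    exact
    { h with
      time_nonneg := ht.1
      time_le := ht.2.trans hT
      sol := hs.isPCRTBPSol (by linarith)
        (fun s hs => by linarith [(le_min_iff.1 (hst s hs)).1])
        (fun s hs => by linarith [(le_min_iff.1 (hst s hs)).2])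
      le_dJ := fun s hs => by linarith [(le_min_iff.1 (hst s hs)).2]
      dS_le := fun s hs => hS s ⟨hs.1, hs.2.trans ht.2⟩ }
  have hpos := pos_of_forall_nonneg_imp_pos (a := 0) (b := T)
    (g := fun s => min (dS μ (q1 s) (q2 s) - δ / 2) (dJ μ (q1 s) (q2 s) - 1 / 10))
    (((hs.continuous_dS.sub continuous_const).min
      (hs.continuous_dJ.sub continuous_const)).continuousOn) ?_ ?_
  · exact key T ⟨hT0, le_rfl⟩ fun s hs => (hpos s hs).le
  · have h1 := h.mass_pos
    have h2 := h.mass_lt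
    have h3 := h.dist_le
    have h4 : 1 - δ ≤ dJ μ (q1 0) (q2 0) := by
      have := (neg_le_abs _).trans (abs_le_dJ μ (q1 0) (q2 0))
      rw [h.q1_zero] at this ⊢
      linarith
    have h5 : δ < 1 / 2 := by nlinarith
    refine lt_min ?_ ?_
    · rw [h.dS_zero]; linarith
    · linarith
  · intro t ht hst
    have hE := key t ht hst
    exact lt_min (by linarith [hE.le_dS]) (by linarith [hE.lt_dJ])

/-- A launched solution reaches the circle of radius `3/2`. -/
lemma exists_ejection (hs : IsCutSol μ (δ / 2) q1 q2 p1 p2) (h : Launch μ δ κ v q1 q2 p1 p2) :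
    ∃ T, Ejection μ δ κ v T q1 q2 p1 p2 ∧ dS μ (q1 T) (q2 T) = 3 / 2 := by
  have hδ := h.dist_pos
  have hδ' : δ < 3 / 2 := by nlinarith [h.mass_pos, h.mass_lt, h.dist_le]
  have hc := hs.continuous_dS
  set S := Set.Icc (0 : ℝ) 3 ∩ (fun t => dS μ (q1 t) (q2 t)) ⁻¹' Set.Ici (3 / 2) with hSdef
  have hcomp : IsCompact S := isCompact_Icc.inter_right (isClosed_Ici.preimage hc)
  have hne : S.Nonempty := by
    by_contra hemp
    have hlt : ∀ t ∈ Set.Icc (0 : ℝ) 3, dS μ (q1 t) (q2 t) < 3 / 2 := fun t ht => by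
      by_contra! hge
      exact hemp ⟨t, ht, hge⟩
    have := (hs.ejection h (by norm_num) le_rfl fun t ht => (hlt t ht).le).le_dS_sq
    have h1 := hlt 3 ⟨by norm_num, le_rfl⟩
    nlinarith [dS_nonneg μ (q1 3) (q2 3)]
  obtain ⟨T, hTS, hmin⟩ := hcomp.exists_isLeast hne
  have hlt : ∀ t ∈ Set.Ico 0 T, dS μ (q1 t) (q2 t) < 3 / 2 := fun t ht => by
    by_contra! hge
    exact absurd (hmin ⟨⟨ht.1, ht.2.le.trans hTS.1.2⟩, hge⟩) (not_le.2 ht.2)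
  have hge : 3 / 2 ≤ dS μ (q1 T) (q2 T) := hTS.2
  have heq : dS μ (q1 T) (q2 T) = 3 / 2 := by
    obtain ⟨t, ht, hte⟩ := intermediate_value_Icc hTS.1.1 hc.continuousOn
      (show (3 / 2 : ℝ) ∈ Set.Icc _ _ from ⟨by rw [h.dS_zero]; linarith, hge⟩)
    rcases ht.2.eq_or_lt with rfl | hlt'
    · exact hte
    · exact absurd hte (hlt t ⟨ht.1, hlt'⟩).ne
  refine ⟨T, hs.ejection h hTS.1.1 hTS.1.2 fun t ht => ?_, heq⟩
  rcases ht.2.eq_or_lt with rfl | hlt'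
  · exact heq.le
  · exact (hlt t ⟨ht.1, hlt'⟩).le

end IsCutSol

/-! ### Motion far from both primaries -/

lemma nrm2_sq (x y : ℝ) : nrm2 x y ^ 2 = x ^ 2 + y ^ 2 := Real.sq_sqrt (by positivity)

lemma nrm2_nonneg (x y : ℝ) : 0 ≤ nrm2 x y := Real.sqrt_nonneg _

lemma abs_le_nrm2 (x y : ℝ) : |x| ≤ nrm2 x y := Real.abs_le_sqrt (by nlinarith [sq_nonneg y])

lemma abs_le_nrm2' (x y : ℝ) : |y| ≤ nrm2 x y := Real.abs_le_sqrt (by nlinarith [sq_nonneg x])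

lemma nrm2_sub_le_dS {μ : ℝ} (hμ : 0 ≤ μ) (x y : ℝ) : nrm2 x y - μ ≤ dS μ x y := by
  have h1 := dS_sq μ x y
  have h2 := nrm2_sq x y
  have h3 := abs_le.1 (abs_le_nrm2 x y)
  by_contra! hlt
  have h4 := dS_nonneg μ x y
  nlinarith

lemma dS_le_nrm2_add {μ : ℝ} (hμ : 0 ≤ μ) (x y : ℝ) : dS μ x y ≤ nrm2 x y + μ := by
  have h1 := dS_sq μ x y
  have h2 := nrm2_sq x y
  have h3 := abs_le.1 (abs_le_nrm2 x y)
  have h4 := nrm2_nonneg x y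
  by_contra! hlt
  nlinarith

lemma nrm2_sub_le_dJ {μ : ℝ} (hμ : μ ≤ 1) (x y : ℝ) : nrm2 x y - (1 - μ) ≤ dJ μ x y := by
  have h1 := dJ_sq μ x y
  have h2 := nrm2_sq x y
  have h3 := abs_le.1 (abs_le_nrm2 x y)
  by_contra! hlt
  have h4 := dJ_nonneg μ x y
  nlinarith

lemma radial_force_bounds {μ r ρ a : ℝ} (hμ0 : 0 < μ) (hμ : μ < 1 / 10 ^ 9) (hr : 0 < r)
    (a1 : (1 - μ) * r ≤ ρ) (a2 : ρ ≤ (1 + μ) * r) (z1 : (1 - μ) * r ^ 2 ≤ a)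
    (z2 : a ≤ (1 + μ) * r ^ 2) :
    0.999 / r ≤ (1 - μ) * a / ρ ^ 3 ∧ (1 - μ) * a / ρ ^ 3 ≤ 1.0005 / r := by
  have hm : 0 < 1 - μ := by linarith
  have hρp : 0 < ρ := lt_of_lt_of_le (by positivity) a1
  have ρ3 : ρ ^ 3 ≤ (1 + μ) ^ 3 * r ^ 3 := mul_pow (1 + μ) r 3 ▸ pow_le_pow_left₀ hρp.le a2 3
  have ρ3' : (1 - μ) ^ 3 * r ^ 3 ≤ ρ ^ 3 :=
    mul_pow (1 - μ) r 3 ▸ pow_le_pow_left₀ (by positivity) a1 3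
  have k1 : (1 + μ) ^ 3 ≤ 1.0001 :=
    (pow_le_pow_left₀ (by linarith) (by linarith : 1 + μ ≤ 1 + 1 / 10 ^ 9) 3).trans (by norm_num)
  have k2 : 0.9999 ≤ (1 - μ) ^ 3 := le_trans (by norm_num)
    (pow_le_pow_left₀ (by norm_num) (by linarith : 1 - 1 / 10 ^ 9 ≤ 1 - μ) 3)
  have k3 : 0.9999 ≤ (1 - μ) ^ 2 := le_trans (by norm_num)
    (pow_le_pow_left₀ (by norm_num) (by linarith : 1 - 1 / 10 ^ 9 ≤ 1 - μ) 2)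
  have hr3 : 0 < r ^ 3 := by positivity
  constructor
  · rw [div_le_div_iff₀ hr (by positivity)]
    calc 0.999 * ρ ^ 3 ≤ 0.999 * (1.0001 * r ^ 3) := by
          gcongr; exact ρ3.trans (by gcongr)
      _ ≤ 0.9999 * r ^ 3 := by linarith
      _ ≤ (1 - μ) ^ 2 * r ^ 3 := by gcongr
      _ = (1 - μ) * ((1 - μ) * r ^ 2) * r := by ring
      _ ≤ (1 - μ) * a * r := by gcongr
  · rw [div_le_div_iff₀ (by positivity) hr]
    calc (1 - μ) * a * r ≤ 1 * ((1 + μ) * r ^ 2) * r := by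
          gcongr
          · exact le_trans (by positivity) z1
          · linarith
      _ = (1 + μ) * r ^ 3 := by ring
      _ ≤ 1.0001 * r ^ 3 := by gcongr; linarith
      _ ≤ 1.0005 * (0.9999 * r ^ 3) := by linarith
      _ ≤ 1.0005 * ((1 - μ) ^ 3 * r ^ 3) := by gcongr
      _ ≤ 1.0005 * ρ ^ 3 := by gcongr

/-- Bounds for the radial force, the torque, and the potential at distance at least `1.3`. -/
lemma far_bounds {μ x y : ℝ} (hμ0 : 0 < μ) (hμ : μ < 1 / 10 ^ 9) (hr : 1.3 ≤ nrm2 x y) :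
    -(1.001 / nrm2 x y ^ 2) ≤ -((1 - μ) * (x * (x + μ) + y ^ 2) / dS μ x y ^ 3
        + μ * (x * (x - (1 - μ)) + y ^ 2) / dJ μ x y ^ 3) / nrm2 x y ∧
    -((1 - μ) * (x * (x + μ) + y ^ 2) / dS μ x y ^ 3
        + μ * (x * (x - (1 - μ)) + y ^ 2) / dJ μ x y ^ 3) / nrm2 x y ≤ -(0.99 / nrm2 x y ^ 2) ∧
    |(1 - μ) * (μ * y) / dS μ x y ^ 3 - μ * ((1 - μ) * y) / dJ μ x y ^ 3| ≤ 100 * μ ∧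
    0.99 / nrm2 x y ≤ (1 - μ) / dS μ x y + μ / dJ μ x y ∧
    (1 - μ) / dS μ x y + μ / dJ μ x y ≤ 1.001 / nrm2 x y := by
  have h1 := nrm2_sub_le_dS hμ0.le x y
  have h2 := dS_le_nrm2_add hμ0.le x y
  have h3 := nrm2_sub_le_dJ (by linarith : μ ≤ 1) x y
  have hx' := abs_le_nrm2 x y
  have hy := abs_le_nrm2' x y
  have hd1 := abs_le_dJ μ x y
  have hd2 := abs_le_dJ' μ x y
  have hr2 := nrm2_sq x y
  generalize nrm2 x y = r at *
  generalize dS μ x y = ρ at *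
  generalize dJ μ x y = D at *
  have hx := abs_le.1 hx'
  have hm : 0 < 1 - μ := by linarith
  have hrp : 0 < r := by linarith
  have hρ1 : 1 ≤ ρ := by linarith
  have hD : 0.23 * r ≤ D := by linarith
  have hρp : 0 < ρ := by linarith
  have hDp : 0 < D := by linarith
  have hrμ : μ ≤ μ * r := le_mul_of_one_le_right hμ0.le (by linarith)
  have hμr : μ * r ≤ μ * r ^ 2 :=
    mul_le_mul_of_nonneg_left (le_self_pow₀ (by linarith) (by norm_num)) hμ0.le
  have hμx := mul_le_mul_of_nonneg_left hx.1 hμ0.le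
  have hμx' := mul_le_mul_of_nonneg_left hx.2 hμ0.le
  have a1 : (1 - μ) * r ≤ ρ := by linarith
  have a2 : ρ ≤ (1 + μ) * r := by linarith
  obtain ⟨b1, b2⟩ := radial_force_bounds (a := x * (x + μ) + y ^ 2) hμ0 hμ hrp a1 a2
    (by linarith) (by linarith)
  have hdot : |x * (x - (1 - μ)) + y ^ 2| ≤ 2 * (r * D) := by
    have e1 := mul_le_mul hx' hd1 (abs_nonneg _) hrp.le
    have e2 := mul_le_mul hy hd2 (abs_nonneg _) hrp.le
    rw [← abs_mul] at e1 e2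
    have e3 := abs_add_le (x * (x - (1 - μ))) (y * y)
    rw [← sq] at e3 e2
    linarith
  have b3 : |μ * (x * (x - (1 - μ)) + y ^ 2) / D ^ 3| ≤ 0.0001 / r := by
    rw [abs_div, abs_mul, abs_of_pos hμ0, abs_of_pos (by positivity : 0 < D ^ 3),
      div_le_div_iff₀ (by positivity) hrp]
    calc μ * |x * (x - (1 - μ)) + y ^ 2| * r ≤ (1 / 10 ^ 9) * (2 * (r * D)) * r := by gcongr
      _ ≤ 0.0001 * ((0.23 * r) ^ 2 * D) := by
        have : 0 < r ^ 2 * D := by positivity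
        linarith
      _ ≤ 0.0001 * (D ^ 2 * D) := by gcongr
      _ = 0.0001 * D ^ 3 := by ring
  have b3' := abs_le.1 b3
  have u1 : 0.99 / r ^ 2 = 0.99 / r / r := by field_simp
  have u2 : 1.001 / r ^ 2 = 1.001 / r / r := by field_simp
  have v1 : 0.999 / r = 0.999 * (1 / r) := by ring
  have v2 : 1.0005 / r = 1.0005 * (1 / r) := by ring
  have v3 : 0.0001 / r = 0.0001 * (1 / r) := by ring
  have v4 : 0.99 / r = 0.99 * (1 / r) := by ring
  have v5 : 1.001 / r = 1.001 * (1 / r) := by ring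
  have hri : 0 < 1 / r := by positivity
  have m1 : μ / D ≤ 0.0001 / r := by
    rw [div_le_div_iff₀ hDp hrp]
    calc μ * r ≤ (1 / 10 ^ 9) * r := by gcongr
      _ ≤ 0.0001 * (0.23 * r) := by linarith
      _ ≤ 0.0001 * D := by gcongr
  have m2 : 0 < μ / D := by positivity
  refine ⟨?_, ?_, ?_, ?_, ?_⟩
  · rw [u2, neg_div, neg_le_neg_iff]
    gcongr
    linarith
  · rw [u1, neg_div, neg_le_neg_iff]
    gcongr
    linarith
  · have c1 : |(1 - μ) * (μ * y) / ρ ^ 3| ≤ 2 * μ := by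
      rw [abs_div, abs_mul, abs_mul, abs_of_pos hm, abs_of_pos hμ0,
        abs_of_pos (by positivity : 0 < ρ ^ 3), div_le_iff₀ (by positivity)]
      calc (1 - μ) * (μ * |y|) ≤ 1 * (μ * r) := by
            gcongr
            linarith
        _ ≤ μ * (2 * ρ ^ 3) := by
            rw [one_mul]
            gcongr
            have : ρ ≤ ρ ^ 3 := le_self_pow₀ hρ1 (by norm_num)
            linarith
        _ = 2 * μ * ρ ^ 3 := by ring
    have c2 : |μ * ((1 - μ) * y) / D ^ 3| ≤ 90 * μ := by
      rw [abs_div, abs_mul, abs_mul, abs_of_pos hm, abs_of_pos hμ0,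
        abs_of_pos (by positivity : 0 < D ^ 3), div_le_iff₀ (by positivity)]
      calc μ * ((1 - μ) * |y|) ≤ μ * (1 * r) := by
            gcongr
            linarith
        _ ≤ μ * (90 * (0.23 ^ 3 * (1.3 ^ 2 * r))) :=
            mul_le_mul_of_nonneg_left (by linarith) hμ0.le
        _ ≤ μ * (90 * (0.23 ^ 3 * (r ^ 2 * r))) := by gcongr
        _ = μ * (90 * (0.23 * r) ^ 3) := by ring
        _ ≤ μ * (90 * D ^ 3) := by gcongr
        _ = 90 * μ * D ^ 3 := by ring
    exact (abs_sub _ _).trans (by linarith)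
  · have : 0.999 / r ≤ (1 - μ) / ρ := by
      rw [div_le_div_iff₀ hrp hρp]
      calc 0.999 * ρ ≤ 0.999 * ((1 + μ) * r) := by gcongr
        _ ≤ 0.999 * ((1 + 1 / 10 ^ 9) * r) := by gcongr
        _ ≤ (1 - 1 / 10 ^ 9) * r := by linarith
        _ ≤ (1 - μ) * r := by gcongr
    linarith
  · have : (1 - μ) / ρ ≤ 1.0005 / r := by
      rw [div_le_div_iff₀ hρp hrp]
      linarith
    linarith

/-- Radial description of a motion at distance `r ≥ 1.3` with radial velocity `u`, angular momentum
`L` and Jacobi constant `H`. -/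
structure FarMotion (μ H : ℝ) (I : Set ℝ) (r u L : ℝ → ℝ) : Prop where
  le_r : ∀ t ∈ I, 1.3 ≤ r t
  hasDerivAt_r : ∀ t ∈ I, HasDerivAt r (u t) t
  hasDerivAt_u : ∀ t ∈ I, HasDerivAt u (deriv u t) t
  le_deriv_u : ∀ t ∈ I, -(1.001 / r t ^ 2) ≤ deriv u t
  deriv_u_le : ∀ t ∈ I, deriv u t ≤ L t ^ 2 / r t ^ 3 - 0.99 / r t ^ 2
  hasDerivAt_L : ∀ t ∈ I, HasDerivAt L (deriv L t) t
  abs_deriv_L : ∀ t ∈ I, |deriv L t| ≤ 100 * μ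
  le_energy : ∀ t ∈ I, 0.99 / r t ≤ u t ^ 2 / 2 + L t ^ 2 / (2 * r t ^ 2) - L t - H
  energy_le : ∀ t ∈ I, u t ^ 2 / 2 + L t ^ 2 / (2 * r t ^ 2) - L t - H ≤ 1.001 / r t

/-- The radial velocity. -/
noncomputable def radVel (x y px py : ℝ) : ℝ := (x * px + y * py) / nrm2 x y

lemma radVel_sq_add {x y : ℝ} (h : 0 < nrm2 x y) (px py : ℝ) :
    radVel x y px py ^ 2 + (x * py - y * px) ^ 2 / nrm2 x y ^ 2 = px ^ 2 + py ^ 2 := by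
  have := nrm2_sq x y
  rw [radVel, div_pow, ← add_div, div_eq_iff (by positivity), this]
  ring

lemma IsPCRTBPSol.farMotion {μ a b : ℝ} {q1 q2 p1 p2 : ℝ → ℝ}
    (h : IsPCRTBPSol μ (Set.Icc a b) q1 q2 p1 p2) (hμ0 : 0 < μ) (hμ : μ < 1 / 10 ^ 9)
    (hr : ∀ t ∈ Set.Icc a b, 1.3 ≤ nrm2 (q1 t) (q2 t)) :
    FarMotion μ (jacobi μ (q1 a) (q2 a) (p1 a) (p2 a)) (Set.Icc a b)
      (fun t => nrm2 (q1 t) (q2 t)) (fun t => radVel (q1 t) (q2 t) (p1 t) (p2 t))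
      (fun t => q1 t * p2 t - q2 t * p1 t) := by
  have hr0 : ∀ t ∈ Set.Icc a b, 0 < nrm2 (q1 t) (q2 t) := fun t ht => by linarith [hr t ht]
  have hdr : ∀ t ∈ Set.Icc a b, HasDerivAt (fun s => nrm2 (q1 s) (q2 s))
      (radVel (q1 t) (q2 t) (p1 t) (p2 t)) t := by
    intro t ht
    have hpos := hr0 t ht
    obtain ⟨-, h1, h2, -, -⟩ := h t ht
    have hne : q1 t ^ 2 + q2 t ^ 2 ≠ 0 := (Real.sqrt_pos.1 hpos).ne'
    have := ((h1.pow 2).add (h2.pow 2)).sqrt hne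
    refine HasDerivAt.congr_deriv this ?_
    change _ / (2 * nrm2 (q1 t) (q2 t)) = _
    rw [radVel, div_eq_div_iff (by positivity) hpos.ne']
    simp only [Nat.cast_ofNat, Nat.add_one_sub_one, pow_one]
    ring
  have hdu : ∀ t ∈ Set.Icc a b,
      HasDerivAt (fun s => radVel (q1 s) (q2 s) (p1 s) (p2 s))
        ((q1 t * p2 t - q2 t * p1 t) ^ 2 / nrm2 (q1 t) (q2 t) ^ 3
          + -((1 - μ) * (q1 t * (q1 t + μ) + q2 t ^ 2) / dS μ (q1 t) (q2 t) ^ 3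
        + μ * (q1 t * (q1 t - (1 - μ)) + q2 t ^ 2) / dJ μ (q1 t) (q2 t) ^ 3)
          / nrm2 (q1 t) (q2 t)) t := by
    intro t ht
    have hpos := hr0 t ht
    have hR := hdr t ht
    have hsq := nrm2_sq (q1 t) (q2 t)
    obtain ⟨-, h1, h2, h3, h4⟩ := h t ht
    refine HasDerivAt.congr_deriv (((h1.mul h3).add (h2.mul h4)).div hR hpos.ne') ?_
    rw [radVel]
    set r := nrm2 (q1 t) (q2 t)
    have e' : ∀ a b : ℝ, (a * r - b * (b / r)) / r ^ 2 = a / r - b ^ 2 / r ^ 3 := by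
      intro a b
      field_simp
    have e : (p1 t ^ 2 + p2 t ^ 2) / r
        = ((q1 t * p2 t - q2 t * p1 t) ^ 2 + (q1 t * p1 t + q2 t * p2 t) ^ 2) / r ^ 3 := by
      field_simp
      linear_combination (p1 t ^ 2 + p2 t ^ 2) * hsq
    simp only [Pi.add_apply, Pi.mul_apply]
    rw [e']
    linear_combination e
  have hdL : ∀ t ∈ Set.Icc a b, HasDerivAt (fun s => q1 s * p2 s - q2 s * p1 s)
      ((1 - μ) * (μ * q2 t) / dS μ (q1 t) (q2 t) ^ 3
        - μ * ((1 - μ) * q2 t) / dJ μ (q1 t) (q2 t) ^ 3) t := by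
    intro t ht
    obtain ⟨-, h1, h2, h3, h4⟩ := h t ht
    refine HasDerivAt.congr_deriv ((h1.mul h4).sub (h2.mul h3)) ?_
    ring
  have hen : ∀ t ∈ Set.Icc a b,
      radVel (q1 t) (q2 t) (p1 t) (p2 t) ^ 2 / 2
        + (q1 t * p2 t - q2 t * p1 t) ^ 2 / (2 * nrm2 (q1 t) (q2 t) ^ 2)
        - (q1 t * p2 t - q2 t * p1 t) - jacobi μ (q1 a) (q2 a) (p1 a) (p2 a)
        = (1 - μ) / dS μ (q1 t) (q2 t) + μ / dJ μ (q1 t) (q2 t) := by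
    intro t ht
    have e1 := (h.mono (Set.Icc_subset_Icc_right ht.2)).jacobi_eq ht.1
    have e2 := radVel_sq_add (hr0 t ht) (p1 t) (p2 t)
    rw [← e1, jacobi, mul_comm 2, ← div_div]
    linear_combination e2 / 2
  have hb := fun t ht => far_bounds hμ0 hμ (hr t ht)
  constructor
  · exact hr
  · exact hdr
  · exact fun t ht => (hdu t ht).differentiableAt.hasDerivAt
  · intro t ht
    rw [(hdu t ht).deriv]
    have : 0 ≤ (q1 t * p2 t - q2 t * p1 t) ^ 2 / nrm2 (q1 t) (q2 t) ^ 3 := by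
      have := hr0 t ht
      positivity
    linarith [(hb t ht).1]
  · intro t ht
    rw [(hdu t ht).deriv]
    linarith [(hb t ht).2.1]
  · exact fun t ht => (hdL t ht).differentiableAt.hasDerivAt
  · intro t ht
    rw [(hdL t ht).deriv]
    exact (hb t ht).2.2.1
  · intro t ht
    rw [hen t ht]
    exact (hb t ht).2.2.2.1
  · intro t ht
    rw [hen t ht]
    exact (hb t ht).2.2.2.2

namespace FarMotion

variable {μ H a b : ℝ} {r u L : ℝ → ℝ}

lemma r_pos {I : Set ℝ} {t : ℝ} (h : FarMotion μ H I r u L) (ht : t ∈ I) : 0 < r t := by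
  linarith [h.le_r t ht]

lemma r_le (h : FarMotion μ H (Set.Icc a b) r u L) (hab : a ≤ b)
    (hu : ∀ t ∈ Set.Icc a b, 0 ≤ u t) : r a ≤ r b := by
  have := mul_sub_le_of_le_deriv hab h.hasDerivAt_r hu
  linarith

/-- Above the (approximate) parabolic speed the radial velocity cannot vanish. -/
lemma escape (h : FarMotion μ H (Set.Icc a b) r u L) (hab : a ≤ b)
    (hu : ∀ t ∈ Set.Icc a b, 0 ≤ u t) (ha : 1.001 / r a < u a ^ 2 / 2) : 0 < u b := by
  have hd : ∀ t ∈ Set.Icc a b, HasDerivAt (fun s => u s ^ 2 / 2 - 1.001 * (r s)⁻¹)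
      (u t * (deriv u t + 1.001 / r t ^ 2)) t := by
    intro t ht
    refine HasDerivAt.congr_deriv ((((h.hasDerivAt_u t ht).pow 2).div_const 2).sub
      (((h.hasDerivAt_r t ht).inv (h.r_pos ht).ne').const_mul 1.001)) ?_
    simp only [Nat.cast_ofNat, Nat.add_one_sub_one, pow_one]
    ring
  have h1 := mul_sub_le_of_le_deriv (c := 0) hab hd fun t ht =>
    mul_nonneg (hu t ht) (by linarith [h.le_deriv_u t ht])
  have hb : b ∈ Set.Icc a b := ⟨hab, le_rfl⟩
  have h2 : 0 < 1.001 * (r b)⁻¹ := by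
    have := h.r_pos hb
    positivity
  refine lt_of_le_of_ne (hu b hb) fun h0 => ?_
  rw [div_eq_mul_inv] at ha
  rw [← h0] at h1
  linarith

/-- At negative energy, the massless body cannot move outwards for long. -/
lemma not_forall_nonneg (h : FarMotion μ H (Set.Icc a (a + 200)) r u L) (hμ : μ < 1 / 10 ^ 9)
    (hH : H ≤ -0.09) (hL : |L a| ≤ 1 / 10 ^ 4) : ¬ ∀ t ∈ Set.Icc a (a + 200), 0 ≤ u t := by
  intro hu
  have hLb : ∀ t ∈ Set.Icc a (a + 200), |L t| ≤ 0.001 := by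
    intro t ht
    have h1 := abs_sub_le_mul_of_abs_deriv_le ht.1
      (fun s hs => h.hasDerivAt_L s ⟨hs.1, hs.2.trans ht.2⟩)
      (fun s hs => (h.abs_deriv_L s ⟨hs.1, hs.2.trans ht.2⟩).trans
        (by linarith : 100 * μ ≤ 1 / 10 ^ 7))
    have h2 := abs_sub_abs_le_abs_sub (L t) (L a)
    linarith [ht.2]
  have hr : ∀ t ∈ Set.Icc a (a + 200), r t ≤ 11.5 := by
    intro t ht
    have h1 := h.energy_le t ht
    have h2 := abs_le.1 (hLb t ht)
    have h3 : 0 ≤ L t ^ 2 / (2 * r t ^ 2) := by positivity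
    have h4 : 0.088 ≤ 1.001 / r t := by linarith [sq_nonneg (u t)]
    rw [le_div_iff₀ (h.r_pos ht)] at h4
    linarith
  have h1 := sub_le_mul_of_deriv_le (c := -0.007) (by linarith) h.hasDerivAt_u fun t ht => by
    have hrp := h.r_pos ht
    have e1 : L t ^ 2 / r t ^ 3 - 0.99 / r t ^ 2 = (L t ^ 2 / r t - 0.99) / r t ^ 2 := by
      field_simp
    have e2 : L t ^ 2 / r t ≤ 0.001 := by
      rw [div_le_iff₀ hrp]
      have := sq_le_sq' (by linarith [(abs_le.1 (hLb t ht)).1]) (abs_le.1 (hLb t ht)).2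
      linarith [h.le_r t ht]
    refine (h.deriv_u_le t ht).trans ?_
    rw [e1, div_le_iff₀ (by positivity)]
    have := pow_le_pow_left₀ hrp.le (hr t ht) 2
    linarith
  have ha : a ∈ Set.Icc a (a + 200) := ⟨le_rfl, by linarith⟩
  have h2 := h.energy_le a ha
  have h3 := abs_le.1 hL
  have h4 : 0 ≤ L a ^ 2 / (2 * r a ^ 2) := by positivity
  have h5 : 1.001 / r a ≤ 0.78 := by
    rw [div_le_iff₀ (h.r_pos ha)]
    linarith [h.le_r a ha]
  have h6 := hu (a + 200) ⟨by linarith, le_rfl⟩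
  nlinarith

/-- Below the parabolic speed the angular momentum cannot become large. -/
lemma abs_L_lt (h : FarMotion μ H (Set.Icc a b) r u L) (hH : |H| ≤ 0.11)
    (hr : ∀ t ∈ Set.Icc a b, 1.49 ≤ r t) (hu : ∀ t ∈ Set.Icc a b, u t ^ 2 / 2 ≤ 1.001 / r t)
    (hL : |L a| < 1) : ∀ t ∈ Set.Icc a b, |L t| < 1 := by
  have hc : ContinuousOn L (Set.Icc a b) :=
    fun t ht => (h.hasDerivAt_L t ht).continuousAt.continuousWithinAt
  suffices ∀ t ∈ Set.Icc a b, 0 < 1 - |L t| from fun t ht => by linarith [this t ht]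
  refine pos_of_forall_nonneg_imp_pos (continuousOn_const.sub hc.abs) (by linarith) ?_
  intro t ht hle
  refine lt_of_le_of_ne (hle t ⟨ht.1, le_rfl⟩) fun h0 => ?_
  have hH' := abs_le.1 hH
  have h1 := h.le_energy t ht
  have h2 := h.energy_le t ht
  have h3 := hu t ht
  have hrt := hr t ht
  have hrp := h.r_pos ht
  have habs : |L t| = 1 := by linarith
  have hsq : L t ^ 2 = 1 := by rw [← sq_abs, habs, one_pow]
  rw [hsq] at h1 h2
  have v1 : 0.99 / r t = 0.99 * (1 / r t) := by ring
  have v2 : 1.001 / r t = 1.001 * (1 / r t) := by ring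
  have v3 : 1 / r t ≤ 0.68 := by rw [div_le_iff₀ hrp]; linarith
  have v4 : 1 / (2 * r t ^ 2) ≤ 0.23 := by
    rw [div_le_iff₀ (by positivity)]
    nlinarith
  have v5 : 0 ≤ 1 / (2 * r t ^ 2) := by positivity
  rcases eq_or_eq_neg_of_abs_eq habs with e | e <;> rw [e] at h1 h2 <;>
    linarith [sq_nonneg (u t)]

lemma deriv_u_le_of_abs_L_lt {I : Set ℝ} {t : ℝ} (h : FarMotion μ H I r u L) (ht : t ∈ I)
    (hr : 1.49 ≤ r t) (hL : |L t| < 1) : deriv u t ≤ -(0.3 / r t ^ 2) := by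
  have hrp := h.r_pos ht
  have e1 : L t ^ 2 / r t ^ 3 - 0.99 / r t ^ 2 = (L t ^ 2 / r t - 0.99) / r t ^ 2 := by
    field_simp
  have e2 : L t ^ 2 / r t ≤ 0.69 := by
    rw [div_le_iff₀ hrp]
    have : L t ^ 2 ≤ 1 := by
      rw [← sq_abs]
      exact pow_le_one₀ (abs_nonneg _) hL.le
    linarith
  refine (h.deriv_u_le t ht).trans ?_
  rw [e1, ← neg_div]
  gcongr
  linarith

/-- A motion which recedes forever without exceeding the parabolic speed is unbounded. -/
lemma tendsto_r (h : ∀ b, FarMotion μ H (Set.Icc a b) r u L)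
    (hr : ∀ t, a ≤ t → 1.49 ≤ r t) (hu : ∀ t, a ≤ t → 0 ≤ u t) (hL : ∀ t, a ≤ t → |L t| < 1) :
    Tendsto r atTop atTop := by
  have hmono : ∀ s t, a ≤ s → s ≤ t → r s ≤ r t := by
    intro s t has hst
    have := mul_sub_le_of_le_deriv hst
      (fun x hx => (h t).hasDerivAt_r x ⟨has.trans hx.1, hx.2⟩) fun x hx => hu x (has.trans hx.1)
    linarith
  have hunb : ∀ M, ∃ t, a ≤ t ∧ M < r t := by
    intro M
    by_contra! hM
    have hMpos : 0 < M := by linarith [hM a le_rfl, hr a le_rfl]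
    set c := 0.3 / M ^ 2
    have hc : 0 < c := by positivity
    have hua := hu a le_rfl
    set b := a + (u a + 1) / c
    have hab : a ≤ b := le_add_of_nonneg_right (by positivity)
    have h1 := sub_le_mul_of_deriv_le (c := -c) hab (h b).hasDerivAt_u fun t ht => by
      refine ((h b).deriv_u_le_of_abs_L_lt ht (hr t ht.1) (hL t ht.1)).trans ?_
      have h2 := (h b).r_pos ht
      have h3 := hM t ht.1
      exact neg_le_neg (div_le_div_of_nonneg_left (by norm_num) (by positivity)
        (pow_le_pow_left₀ h2.le h3 2))
    have h2 : c * (b - a) = u a + 1 := by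
      rw [add_sub_cancel_left, mul_div_cancel₀ _ hc.ne']
    linarith [hu b hab]
  refine tendsto_atTop.2 fun M => ?_
  obtain ⟨t, hat, ht⟩ := hunb M
  filter_upwards [eventually_ge_atTop t] with s hs
  exact ht.le.trans (hmono t s hat hs)

end FarMotion

lemma radVel_nonneg_iff {x y px py : ℝ} (h : 0 < nrm2 x y) :
    0 ≤ radVel x y px py ↔ 0 ≤ x * px + y * py := by
  rw [radVel, le_div_iff₀ h, zero_mul]

lemma radVel_pos_iff {x y px py : ℝ} (h : 0 < nrm2 x y) :
    0 < radVel x y px py ↔ 0 < x * px + y * py := div_pos_iff_of_pos_right h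

lemma lt_radVel_sq_iff {x y px py : ℝ} (h : 0 < nrm2 x y) :
    1.001 / nrm2 x y < radVel x y px py ^ 2 / 2 ↔
      2.002 * nrm2 x y < (x * px + y * py) ^ 2 := by
  rw [radVel, div_pow, div_div, div_lt_div_iff₀ h (by positivity),
    show 1.001 * (nrm2 x y ^ 2 * 2) = 2.002 * nrm2 x y * nrm2 x y by ring, mul_lt_mul_iff_left₀ h]

/-! ### The end of the ejection phase -/

namespace Ejection

variable {μ δ κ v T : ℝ} {q1 q2 p1 p2 : ℝ → ℝ}

lemma sq_add_sq_le (h : Ejection μ δ κ v T q1 q2 p1 p2) (hr : 1.3 ≤ nrm2 (q1 T) (q2 T)) :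
    p1 T ^ 2 + (p2 T + μ) ^ 2 ≤ 4 := by
  have h1 := h.mass_pos
  have h2 := h.mass_lt
  have h3 := nrm2_sub_le_dS h1.le (q1 T) (q2 T)
  have h4 := abs_le.1 h.abs_energy_sub_le
  have h5 : (1 - μ) / dS μ (q1 T) (q2 T) ≤ 0.8 := by
    rw [div_le_iff₀ (by linarith)]
    linarith
  linarith [abs_le.1 h.abs_energy_le]

lemma dot_pos (h : Ejection μ δ κ v T q1 q2 p1 p2) (hr : 1.3 ≤ nrm2 (q1 T) (q2 T)) :
    0 < q1 T * p1 T + q2 T * p2 T := by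
  have h1 := h.mass_pos
  have h2 := h.mass_lt
  have h3 := nrm2_sub_le_dS h1.le (q1 T) (q2 T)
  have h4 := h.sq_add_sq_le hr
  have h5 : |p1 T| ≤ 2 := abs_le_of_sq_le_sq (by nlinarith [sq_nonneg (p2 T + μ)]) (by norm_num)
  have h6 := abs_le.1 ((abs_le_dS' μ (q1 T) (q2 T)).trans
    (h.dS_le T ⟨h.time_nonneg, le_rfl⟩))
  have h7 := h.le_virial_sq
  have h8 : 0.5 ≤ (q1 T + μ) * p1 T + q2 T * (p2 T + μ) := by
    refine (sq_le_sq₀ (by norm_num) h.virial_nonneg).1 (le_trans ?_ h7)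
    have := h.dist_pos
    have : δ ≤ 0.1 := h.dist_le.trans (by nlinarith)
    nlinarith
  nlinarith [abs_le.1 h5]

lemma abs_angMom_far_le (h : Ejection μ δ κ v T q1 q2 p1 p2) (hr : 1.3 ≤ nrm2 (q1 T) (q2 T)) :
    |q1 T * p2 T - q2 T * p1 T| ≤ 1 / 10 ^ 4 := by
  have h1 := h.mass_pos
  have h2 := h.mass_lt
  have h4 := h.sq_add_sq_le hr
  have h5 := abs_le.1 (abs_le_of_sq_le_sq (by nlinarith [sq_nonneg (p1 T)] : (p2 T + μ) ^ 2 ≤ 2 ^ 2)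
    (by norm_num))
  have h6 := abs_le.1 ((abs_le_dS μ (q1 T) (q2 T)).trans
    (h.dS_le T ⟨h.time_nonneg, le_rfl⟩))
  have h7 := abs_le.1 h.abs_angMom_le
  rw [abs_le]
  constructor <;> nlinarith

lemma abs_jacobi_end_sub_le (h : Ejection μ δ κ v T q1 q2 p1 p2) :
    |jacobi μ (q1 T) (q2 T) (p1 T) (p2 T) - κ| ≤ 1 / 10 ^ 7 := by
  rw [h.sol.jacobi_eq h.time_nonneg]
  exact h.abs_jacobi_sub_le

end Ejection

/-! ### Turning, escaping and parabolic motions -/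

namespace IsCutSol

variable {μ c δ κ v T : ℝ} {q1 q2 p1 p2 : ℝ → ℝ}

lemma continuous_nrm2 (h : IsCutSol μ c q1 q2 p1 p2) : Continuous fun t => nrm2 (q1 t) (q2 t) := by
  have := h.continuous_q1
  have := h.continuous_q2
  unfold nrm2
  fun_prop

lemma continuous_dot (h : IsCutSol μ c q1 q2 p1 p2) :
    Continuous fun t => q1 t * p1 t + q2 t * p2 t :=
  (h.continuous_q1.mul h.continuous_p1).add (h.continuous_q2.mul h.continuous_p2)

lemma isPCRTBPSol_far {I : Set ℝ} (hs : IsCutSol μ (δ / 2) q1 q2 p1 p2)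
    (h : Launch μ δ κ v q1 q2 p1 p2) (hr : ∀ t ∈ I, 1.3 ≤ nrm2 (q1 t) (q2 t)) :
    IsPCRTBPSol μ I q1 q2 p1 p2 := by
  have h1 := h.mass_pos
  have h2 := h.mass_lt
  have h3 : δ ≤ 0.1 := h.dist_le.trans (by nlinarith)
  refine hs.isPCRTBPSol (by linarith [h.dist_pos]) (fun t ht => ?_) fun t ht => ?_
  · linarith [nrm2_sub_le_dS h1.le (q1 t) (q2 t), hr t ht]
  · linarith [nrm2_sub_le_dJ (by linarith : μ ≤ 1) (q1 t) (q2 t), hr t ht]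

lemma farMotion {a b : ℝ} (hs : IsCutSol μ (δ / 2) q1 q2 p1 p2)
    (h : Launch μ δ κ v q1 q2 p1 p2) (hr : ∀ t ∈ Set.Icc a b, 1.3 ≤ nrm2 (q1 t) (q2 t)) :
    FarMotion μ (jacobi μ (q1 a) (q2 a) (p1 a) (p2 a)) (Set.Icc a b)
      (fun t => nrm2 (q1 t) (q2 t)) (fun t => radVel (q1 t) (q2 t) (p1 t) (p2 t))
      (fun t => q1 t * p2 t - q2 t * p1 t) :=
  (hs.isPCRTBPSol_far h hr).farMotion h.mass_pos h.mass_lt hr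

lemma dot_pos_of_escape {a t : ℝ} (hs : IsCutSol μ (δ / 2) q1 q2 p1 p2)
    (h : Launch μ δ κ v q1 q2 p1 p2) (hr : 1.3 < nrm2 (q1 a) (q2 a))
    (hd : 0 < q1 a * p1 a + q2 a * p2 a)
    (he : 2.002 * nrm2 (q1 a) (q2 a) < (q1 a * p1 a + q2 a * p2 a) ^ 2) (ht : a ≤ t) :
    0 < q1 t * p1 t + q2 t * p2 t := by
  refine (lt_min_iff.1 (pos_of_forall_nonneg_imp_pos (a := a) (b := t)
    (g := fun s => min (q1 s * p1 s + q2 s * p2 s) (nrm2 (q1 s) (q2 s) - 1.3))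
    (hs.continuous_dot.min (hs.continuous_nrm2.sub continuous_const)).continuousOn
    (lt_min hd (by linarith)) (fun x hx hle => ?_) t ⟨ht, le_rfl⟩)).1
  have hr' : ∀ s ∈ Set.Icc a x, 1.3 ≤ nrm2 (q1 s) (q2 s) := fun s hs => by
    linarith [(le_min_iff.1 (hle s hs)).2]
  have hpos : ∀ s ∈ Set.Icc a x, 0 < nrm2 (q1 s) (q2 s) := fun s hs => by linarith [hr' s hs]
  have hF := hs.farMotion h hr'
  have hu : ∀ s ∈ Set.Icc a x, 0 ≤ radVel (q1 s) (q2 s) (p1 s) (p2 s) := fun s hs =>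
    (radVel_nonneg_iff (hpos s hs)).2 (le_min_iff.1 (hle s hs)).1
  have h1 := hF.r_le hx.1 hu
  have h2 := hF.escape hx.1 hu ((lt_radVel_sq_iff (hpos a ⟨le_rfl, hx.1⟩)).2 he)
  exact lt_min ((radVel_pos_iff (hpos x ⟨hx.1, le_rfl⟩)).1 h2) (by linarith)

end IsCutSol

namespace Ejection

variable {μ δ κ v T : ℝ} {q1 q2 p1 p2 : ℝ → ℝ}

lemma dot_pos_or_lt {t : ℝ} (hE : Ejection μ δ κ v T q1 q2 p1 p2) (ht : t ∈ Set.Icc 0 T) :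
    0 < q1 t * p1 t + q2 t * p2 t ∨ nrm2 (q1 t) (q2 t) < 1.35 :=
  (le_or_gt 1.3 (nrm2 (q1 t) (q2 t))).imp (hE.restrict ht).dot_pos fun h => by linarith

lemma le_nrm2 (hE : Ejection μ δ κ v T q1 q2 p1 p2) (hT : dS μ (q1 T) (q2 T) = 3 / 2) :
    1.499 ≤ nrm2 (q1 T) (q2 T) := by
  linarith [dS_le_nrm2_add hE.mass_pos.le (q1 T) (q2 T), hE.mass_lt]

/-- At positive energy, the speed exceeds the parabolic speed. -/
lemma escape_of_energy_eq (hE : Ejection μ δ κ v T q1 q2 p1 p2)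
    (hs : IsCutSol μ (δ / 2) q1 q2 p1 p2) (hT : dS μ (q1 T) (q2 T) = 3 / 2) (hκ : κ = 1 / 10) :
    2.002 * nrm2 (q1 T) (q2 T) < (q1 T * p1 T + q2 T * p2 T) ^ 2 := by
  have hr := hE.le_nrm2 hT
  have hF := hs.farMotion (a := T) (b := T) hE.toLaunch
    (fun t ht => by rw [Set.Icc_self] at ht; rw [ht]; linarith)
  have h1 := hF.le_energy T ⟨le_rfl, le_rfl⟩
  have h2 := abs_le.1 hE.abs_jacobi_end_sub_le
  have h3 := abs_le.1 (hE.abs_angMom_far_le (by linarith))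
  have h4 := sq_le_sq' h3.1 h3.2
  set r := nrm2 (q1 T) (q2 T)
  set L := q1 T * p2 T - q2 T * p1 T
  have hrp : 0 < r := by linarith
  have h5 : L ^ 2 / (2 * r ^ 2) ≤ 0.001 := by
    rw [div_le_iff₀ (by positivity)]
    nlinarith
  have h6 : 0.011 * (1 / r) ≤ 0.01 := by
    rw [mul_one_div, div_le_iff₀ hrp]
    linarith
  have v1 : 0.99 / r = 0.99 * (1 / r) := by ring
  have v2 : 1.001 / r = 1.001 * (1 / r) := by ring
  refine (lt_radVel_sq_iff hrp).1 ?_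
  change 1.001 / r < _
  linarith

variable (hE : Ejection μ δ κ v T q1 q2 p1 p2) (hs : IsCutSol μ (δ / 2) q1 q2 p1 p2)
  (hT : dS μ (q1 T) (q2 T) = 3 / 2)
  (hA : ∀ t, 0 ≤ t → 1.35 < nrm2 (q1 t) (q2 t) → 0 ≤ q1 t * p1 t + q2 t * p2 t)
include hE hs hT hA

lemma le_nrm2_of_no_turn {t : ℝ} (ht : T ≤ t) : 1.49 ≤ nrm2 (q1 t) (q2 t) := by
  have h0 := hE.time_nonneg
  have hrT := hE.le_nrm2 hT
  have := pos_of_forall_nonneg_imp_pos (a := T) (b := t)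
    (g := fun s => nrm2 (q1 s) (q2 s) - 1.49)
    (hs.continuous_nrm2.sub continuous_const).continuousOn (by linarith)
    (fun x hx hle => ?_) t ⟨ht, le_rfl⟩
  · linarith
  · have hr' : ∀ s ∈ Set.Icc T x, 1.49 ≤ nrm2 (q1 s) (q2 s) := fun s hs => by linarith [hle s hs]
    have := (hs.farMotion hE.toLaunch fun s hs => le_trans (by norm_num) (hr' s hs)).r_le hx.1
      fun s hs => (radVel_nonneg_iff (by linarith [hr' s hs])).2
        (hA s (h0.trans hs.1) (by linarith [hr' s hs]))
    linarith

lemma farMotion_of_no_turn {a : ℝ} (ha : T ≤ a) (b : ℝ) :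
    FarMotion μ (jacobi μ (q1 a) (q2 a) (p1 a) (p2 a)) (Set.Icc a b)
      (fun t => nrm2 (q1 t) (q2 t)) (fun t => radVel (q1 t) (q2 t) (p1 t) (p2 t))
      (fun t => q1 t * p2 t - q2 t * p1 t) :=
  hs.farMotion hE.toLaunch fun _ ht =>
    le_trans (by norm_num) (hE.le_nrm2_of_no_turn hs hT hA (ha.trans ht.1))

lemma radVel_nonneg_of_no_turn {t : ℝ} (ht : T ≤ t) : 0 ≤ radVel (q1 t) (q2 t) (p1 t) (p2 t) := by
  have := hE.le_nrm2_of_no_turn hs hT hA ht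
  exact (radVel_nonneg_iff (by linarith)).2 (hA t (hE.time_nonneg.trans ht) (by linarith))

lemma energy_ne_of_no_turn : κ ≠ -(1 / 10) := by
  intro hκ
  have h2 := abs_le.1 hE.abs_jacobi_end_sub_le
  exact (hE.farMotion_of_no_turn hs hT hA le_rfl (T + 200)).not_forall_nonneg hE.mass_lt
    (by linarith) (hE.abs_angMom_far_le (by linarith [hE.le_nrm2 hT]))
    fun t ht => hE.radVel_nonneg_of_no_turn hs hT hA ht.1

lemma abs_angMom_lt_of_no_turn {t : ℝ} (ht : T ≤ t)
    (hB : ∀ x ∈ Set.Icc T t, (q1 x * p1 x + q2 x * p2 x) ^ 2 ≤ 2.002 * nrm2 (q1 x) (q2 x)) :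
    |q1 t * p2 t - q2 t * p1 t| < 1 := by
  have h2 := abs_le.1 hE.abs_jacobi_end_sub_le
  have h3 := abs_le.1 hE.abs_energy_le
  refine (hE.farMotion_of_no_turn hs hT hA le_rfl t).abs_L_lt
    (abs_le.2 ⟨by linarith, by linarith⟩) (fun x hx => hE.le_nrm2_of_no_turn hs hT hA hx.1)
    (fun x hx => ?_)
    ((hE.abs_angMom_far_le (by linarith [hE.le_nrm2 hT])).trans_lt (by norm_num)) t ⟨ht, le_rfl⟩
  have := hE.le_nrm2_of_no_turn hs hT hA hx.1
  exact not_lt.1 fun hlt => not_lt.2 (hB x hx) ((lt_radVel_sq_iff (by linarith)).1 hlt)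

lemma dot_pos_of_no_turn {t : ℝ} (ht : T ≤ t) : 0 < q1 t * p1 t + q2 t * p2 t := by
  have hr := fun {x} (hx : T ≤ x) => hE.le_nrm2_of_no_turn hs hT hA hx
  refine lt_of_le_of_ne (hA t (hE.time_nonneg.trans ht) (by linarith [hr ht])) fun h0 => ?_
  have hTt : T < t := lt_of_le_of_ne ht fun he => by
    subst he
    linarith [hE.dot_pos (by linarith [hr ht])]
  have hB : ∀ x ∈ Set.Icc T t,
      (q1 x * p1 x + q2 x * p2 x) ^ 2 ≤ 2.002 * nrm2 (q1 x) (q2 x) := by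
    intro x hx
    by_contra! hlt
    have hd : 0 < q1 x * p1 x + q2 x * p2 x := by
      refine lt_of_le_of_ne (hA x (hE.time_nonneg.trans hx.1) (by linarith [hr hx.1])) fun hx0 => ?_
      rw [← hx0] at hlt
      linarith [hr hx.1]
    linarith [hs.dot_pos_of_escape hE.toLaunch (by linarith [hr hx.1]) hd hlt hx.2]
  have hL := hE.abs_angMom_lt_of_no_turn hs hT hA ht hB
  have hF := hE.farMotion_of_no_turn hs hT hA le_rfl t
  have hmem : t ∈ Set.Icc T t := ⟨ht, le_rfl⟩
  have hlt := hF.deriv_u_le_of_abs_L_lt hmem (hr ht) hL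
  have hrt := hF.r_pos hmem
  have hneg : -(0.3 / nrm2 (q1 t) (q2 t) ^ 2) < 0 := by
    have : 0 < nrm2 (q1 t) (q2 t) := hrt
    rw [neg_lt_zero]
    positivity
  have hmin : IsLocalMin (fun s => radVel (q1 s) (q2 s) (p1 s) (p2 s)) t := by
    filter_upwards [Ioi_mem_nhds hTt] with s hs'
    have : radVel (q1 t) (q2 t) (p1 t) (p2 t) = 0 := by rw [radVel, ← h0, zero_div]
    rw [this]
    exact hE.radVel_nonneg_of_no_turn hs hT hA (le_of_lt hs')
  rw [hmin.deriv_eq_zero] at hlt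
  linarith

lemma isPCRTBPSol_nonneg : IsPCRTBPSol μ (Set.Ici 0) q1 q2 p1 p2 := by
  intro t ht
  rcases le_total t T with htT | htT
  · exact hE.sol t ⟨ht, htT⟩
  · exact hs.isPCRTBPSol_far hE.toLaunch (I := Set.Ici T)
      (fun x hx => by linarith [hE.le_nrm2_of_no_turn hs hT hA hx]) t htT

variable (hB : ∀ t, 0 ≤ t → 1.3 < nrm2 (q1 t) (q2 t) → 0 < q1 t * p1 t + q2 t * p2 t →
  (∀ x ∈ Set.Icc 0 t, 0 < q1 x * p1 x + q2 x * p2 x ∨ nrm2 (q1 x) (q2 x) < 1.35) →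
  (q1 t * p1 t + q2 t * p2 t) ^ 2 ≤ 2.002 * nrm2 (q1 t) (q2 t))
include hB

lemma dot_sq_le {t : ℝ} (ht : T ≤ t) :
    (q1 t * p1 t + q2 t * p2 t) ^ 2 ≤ 2.002 * nrm2 (q1 t) (q2 t) := by
  refine hB t (hE.time_nonneg.trans ht) (by linarith [hE.le_nrm2_of_no_turn hs hT hA ht])
    (hE.dot_pos_of_no_turn hs hT hA ht) fun x hx => ?_
  rcases le_total x T with hxT | hxT
  · exact hE.dot_pos_or_lt ⟨hx.1, hxT⟩
  · exact Or.inl (hE.dot_pos_of_no_turn hs hT hA hxT)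

lemma abs_angMom_lt {t : ℝ} (ht : T ≤ t) : |q1 t * p2 t - q2 t * p1 t| < 1 :=
  hE.abs_angMom_lt_of_no_turn hs hT hA ht fun _ hx => hE.dot_sq_le hs hT hA hB hx.1

lemma tendsto_nrm2 : Tendsto (fun t => nrm2 (q1 t) (q2 t)) atTop atTop :=
  FarMotion.tendsto_r (hE.farMotion_of_no_turn hs hT hA le_rfl)
    (fun _ ht => hE.le_nrm2_of_no_turn hs hT hA ht)
    (fun _ ht => hE.radVel_nonneg_of_no_turn hs hT hA ht)
    fun _ ht => hE.abs_angMom_lt hs hT hA hB ht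

lemma tendsto_nrm2_momentum : Tendsto (fun t => nrm2 (p1 t) (p2 t)) atTop (𝓝 0) := by
  have hlim := (hE.tendsto_nrm2 hs hT hA hB).inv_tendsto_atTop
  have h2 := (hlim.const_mul 2.002).add (hlim.pow 2)
  have h3 := h2.sqrt
  simp only [mul_zero, ne_eq, OfNat.ofNat_ne_zero, not_false_eq_true, zero_pow, add_zero,
    Real.sqrt_zero] at h3
  refine squeeze_zero' (.of_forall fun t => nrm2_nonneg _ _) ?_ h3
  filter_upwards [eventually_ge_atTop T] with t ht
  have hr := hE.le_nrm2_of_no_turn hs hT hA ht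
  have hrp : 0 < nrm2 (q1 t) (q2 t) := by linarith
  refine Real.sqrt_le_sqrt ?_
  rw [← radVel_sq_add hrp]
  refine add_le_add ?_ ?_
  · rw [radVel, div_pow, div_le_iff₀ (by positivity)]
    refine (hE.dot_sq_le hs hT hA hB ht).trans_eq ?_
    simp only [Pi.inv_apply]
    field_simp
  · simp only [Pi.inv_apply]
    rw [inv_pow, ← one_div]
    gcongr
    rw [← sq_abs]
    exact pow_le_one₀ (abs_nonneg _) (hE.abs_angMom_lt hs hT hA hB ht).le

end Ejection

/-! ### Reversibility -/

namespace IsCutSol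

variable {μ c : ℝ} {q1 q2 p1 p2 : ℝ → ℝ}

lemma hasDerivAt (h : IsCutSol μ c q1 q2 p1 p2) (t : ℝ) :
    HasDerivAt (fun s => (q1 s, q2 s, p1 s, p2 s))
      (cutField μ c (1 / 10) (q1 t, q2 t, p1 t, p2 t)) t :=
  (h.hasDerivAt_q1 t).prodMk ((h.hasDerivAt_q2 t).prodMk
    ((h.hasDerivAt_p1 t).prodMk (h.hasDerivAt_p2 t)))

lemma reverse (h : IsCutSol μ c q1 q2 p1 p2) :
    IsCutSol μ c (fun t => q1 (-t)) (fun t => -q2 (-t)) (fun t => -p1 (-t)) fun t => p2 (-t) where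
  hasDerivAt_q1 t := by
    refine ((h.hasDerivAt_q1 (-t)).comp t (hasDerivAt_neg t)).congr_deriv ?_
    ring
  hasDerivAt_q2 t := by
    refine ((h.hasDerivAt_q2 (-t)).comp t (hasDerivAt_neg t)).neg.congr_deriv ?_
    ring
  hasDerivAt_p1 t := by
    refine ((h.hasDerivAt_p1 (-t)).comp t (hasDerivAt_neg t)).neg.congr_deriv ?_
    simp only [cutForce, neg_sq]
    ring
  hasDerivAt_p2 t := by
    refine ((h.hasDerivAt_p2 (-t)).comp t (hasDerivAt_neg t)).congr_deriv ?_
    simp only [cutForce, neg_sq]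
    ring

lemma eq_reverse (h : IsCutSol μ c q1 q2 p1 p2) (hμ0 : 0 ≤ μ) (hμ1 : μ ≤ 1) (hc : 0 < c)
    (hq : q2 0 = 0) (hp : p1 0 = 0) (t : ℝ) :
    q1 (-t) = q1 t ∧ -q2 (-t) = q2 t ∧ -p1 (-t) = p1 t ∧ p2 (-t) = p2 t := by
  obtain ⟨K, hK⟩ := exists_lipschitzWith_cutField hμ0 hμ1 hc (by norm_num : (0 : ℝ) < 1 / 10)
  have := ODE_solution_unique_univ (v := fun _ => cutField μ c (1 / 10)) (s := fun _ => Set.univ)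
    (t₀ := 0) (fun _ => hK.lipschitzOnWith) (fun t => ⟨h.reverse.hasDerivAt t, trivial⟩)
    (fun t => ⟨h.hasDerivAt t, trivial⟩) (by simp [hq, hp])
  simpa only [Prod.mk.injEq] using congrFun this t

end IsCutSol

lemma IsPCRTBPSol.univ_of_reversible {μ : ℝ} {q1 q2 p1 p2 : ℝ → ℝ}
    (h : IsPCRTBPSol μ (Set.Ici 0) q1 q2 p1 p2)
    (hrev : ∀ t, q1 (-t) = q1 t ∧ -q2 (-t) = q2 t ∧ -p1 (-t) = p1 t ∧ p2 (-t) = p2 t) :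
    IsPCRTBPSol μ Set.univ q1 q2 p1 p2 := by
  intro t _
  rcases le_total 0 t with ht | ht
  · exact h t ht
  obtain ⟨⟨s, j⟩, h1, h2, h3, h4⟩ := h (-t) (neg_nonneg.2 ht)
  have e1 : q1 = fun x => q1 (-x) := funext fun x => (hrev x).1.symm
  have e2 : q2 = fun x => -q2 (-x) := funext fun x => (hrev x).2.1.symm
  have e3 : p1 = fun x => -p1 (-x) := funext fun x => (hrev x).2.2.1.symm
  have e4 : p2 = fun x => p2 (-x) := funext fun x => (hrev x).2.2.2.symm
  obtain ⟨g1, g2, g3, g4⟩ := hrev (-t)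
  rw [neg_neg] at g1 g2 g3 g4
  have hS : dS μ (q1 (-t)) (q2 (-t)) = dS μ (q1 t) (q2 t) := by
    rw [← g1, ← g2, dS, dS, neg_sq]
  have hJ : dJ μ (q1 (-t)) (q2 (-t)) = dJ μ (q1 t) (q2 t) := by
    rw [← g1, ← g2, dJ, dJ, neg_sq]
  refine ⟨⟨fun he => s ?_, fun he => j ?_⟩, ?_, ?_, ?_, ?_⟩
  · rw [Prod.mk.injEq] at he ⊢
    exact ⟨g1 ▸ he.1, by rw [← g2, he.2, neg_zero]⟩
  · rw [Prod.mk.injEq] at he ⊢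
    exact ⟨g1 ▸ he.1, by rw [← g2, he.2, neg_zero]⟩
  · rw [e1]
    refine (h1.comp t (hasDerivAt_neg t)).congr_deriv ?_
    rw [← g3, ← g2]
    ring
  · rw [e2]
    refine (h2.comp t (hasDerivAt_neg t)).neg.congr_deriv ?_
    rw [← g4, ← g1]
    ring
  · rw [e3]
    refine (h3.comp t (hasDerivAt_neg t)).neg.congr_deriv ?_
    rw [hS, hJ, ← g4, ← g1]
    ring
  · rw [e4]
    refine (h4.comp t (hasDerivAt_neg t)).congr_deriv ?_
    rw [hS, hJ, ← g3, ← g2]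
    ring

/-! ### Existence of a parabolic ejection -/

lemma isOpen_setOf_exists_forall_lt_or {R S : ℝ → ℝ → ℝ} (hR : Continuous fun y : ℝ × ℝ => R y.1 y.2)
    (hS : Continuous fun y : ℝ × ℝ => S y.1 y.2) :
    IsOpen {k | ∃ t, 0 ≤ t ∧ 1.3 < R k t ∧ 0 < S k t ∧ 2.002 * R k t < S k t ^ 2 ∧
      ∀ x ∈ Set.Icc 0 t, 0 < S k x ∨ R k x < 1.35} := by
  refine isOpen_iff_mem_nhds.2 fun k ⟨t, h0, h1, h2, h3, h4⟩ => ?_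
  have hRt : Continuous fun k => R k t := hR.comp (by fun_prop : Continuous fun k : ℝ => (k, t))
  have hSt : Continuous fun k => S k t := hS.comp (by fun_prop : Continuous fun k : ℝ => (k, t))
  have hev : ∀ᶠ k' in 𝓝 k, ∀ x ∈ Set.Icc 0 t, 0 < S k' x ∨ R k' x < 1.35 :=
    isCompact_Icc.eventually_forall_of_forall_eventually fun x hx =>
      ((isOpen_lt continuous_const hS).union (isOpen_lt hR continuous_const)).mem_nhds (h4 x hx)
  filter_upwards [hev, (isOpen_lt continuous_const hRt).mem_nhds h1,
    (isOpen_lt continuous_const hSt).mem_nhds h2,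
    (isOpen_lt (hRt.const_mul 2.002) (hSt.pow 2)).mem_nhds h3] with k' g4 g1 g2 g3
  exact ⟨t, h0, g1, g2, g3, g4⟩

lemma isOpen_setOf_exists_lt_and {R S : ℝ → ℝ → ℝ} (hR : Continuous fun y : ℝ × ℝ => R y.1 y.2)
    (hS : Continuous fun y : ℝ × ℝ => S y.1 y.2) :
    IsOpen {k | ∃ t, 0 ≤ t ∧ 1.35 < R k t ∧ S k t < 0} := by
  refine isOpen_iff_mem_nhds.2 fun k ⟨t, h0, h1, h2⟩ => ?_
  have hRt : Continuous fun k => R k t := hR.comp (by fun_prop : Continuous fun k : ℝ => (k, t))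
  have hSt : Continuous fun k => S k t := hS.comp (by fun_prop : Continuous fun k : ℝ => (k, t))
  filter_upwards [(isOpen_lt continuous_const hRt).mem_nhds h1,
    (isOpen_lt hSt continuous_const).mem_nhds h2] with k' g1 g2
  exact ⟨t, h0, g1, g2⟩

lemma exists_launch_family {μ δ : ℝ} (hμ0 : 0 < μ) (hμ : μ < 1 / 10 ^ 9) (hδ0 : 0 < δ)
    (hδ : δ ≤ μ ^ 2 / 4) :
    ∃ (v : ℝ → ℝ) (q1 q2 p1 p2 : ℝ → ℝ → ℝ),
      (∀ κ, IsCutSol μ (δ / 2) (q1 κ) (q2 κ) (p1 κ) (p2 κ)) ∧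
      (∀ κ ∈ Set.Icc (-(1 / 10)) (1 / 10 : ℝ),
        Launch μ δ κ (v κ) (q1 κ) (q2 κ) (p1 κ) (p2 κ)) ∧
      (Continuous fun y : ℝ × ℝ => nrm2 (q1 y.1 |y.2|) (q2 y.1 |y.2|)) ∧
      Continuous fun y : ℝ × ℝ => q1 y.1 |y.2| * p1 y.1 |y.2| + q2 y.1 |y.2| * p2 y.1 |y.2| := by
  obtain ⟨K, hK⟩ := exists_lipschitzWith_cutField hμ0.le (by linarith : μ ≤ 1) (half_pos hδ0)
    (by norm_num : (0 : ℝ) < 1 / 10)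
  obtain ⟨φ, h0, hφ, hc⟩ := exists_continuous_family_solution hK
    (x := fun κ => ((δ - μ, 0, 0, √(2 * ((1 - μ) / δ + κ)) - μ) : ℝ × ℝ × ℝ × ℝ)) (by fun_prop)
  have hcont : Continuous fun y : ℝ × ℝ => φ y.1 |y.2| :=
    hc.comp_continuous (f := fun y : ℝ × ℝ => (y.1, |y.2|)) (by fun_prop) fun y => abs_nonneg y.2
  refine ⟨fun κ => √(2 * ((1 - μ) / δ + κ)), fun κ t => (φ κ t).1, fun κ t => (φ κ t).2.1,
    fun κ t => (φ κ t).2.2.1, fun κ t => (φ κ t).2.2.2, fun κ => isCutSol_of_hasDerivAt (hφ κ),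
    fun κ hκ => ?_, ?_, ?_⟩
  · have hpos : 0 < 2 * ((1 - μ) / δ + κ) := by
      have : 0.9 ≤ (1 - μ) / δ := by
        rw [le_div_iff₀ hδ0]
        nlinarith
      linarith [hκ.1]
    exact
    { mass_pos := hμ0
      mass_lt := hμ
      dist_pos := hδ0
      dist_le := hδ
      abs_energy_le := abs_le.2 hκ
      speed_pos := Real.sqrt_pos.2 hpos
      speed_sq := by
        rw [Real.sq_sqrt hpos.le]
        field_simp
      q1_zero := by simp only [h0]
      q2_zero := by simp only [h0]
      p1_zero := by simp only [h0]
      p2_zero := by simp only [h0] }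
  · exact ((hcont.fst.pow 2).add (hcont.snd.fst.pow 2)).sqrt
  · exact (hcont.fst.mul hcont.snd.snd.fst).add (hcont.snd.fst.mul hcont.snd.snd.snd)

/-- For any small `δ`, some orbit launched at distance `δ` is neither turning back nor escaping. -/
lemma exists_parabolic {μ δ : ℝ} (hμ0 : 0 < μ) (hμ : μ < 1 / 10 ^ 9) (hδ0 : 0 < δ)
    (hδ : δ ≤ μ ^ 2 / 4) :
    ∃ (κ v T : ℝ) (q1 q2 p1 p2 : ℝ → ℝ), Ejection μ δ κ v T q1 q2 p1 p2 ∧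
      IsCutSol μ (δ / 2) q1 q2 p1 p2 ∧ dS μ (q1 T) (q2 T) = 3 / 2 ∧
      (∀ t, 0 ≤ t → 1.35 < nrm2 (q1 t) (q2 t) → 0 ≤ q1 t * p1 t + q2 t * p2 t) ∧
      ∀ t, 0 ≤ t → 1.3 < nrm2 (q1 t) (q2 t) → 0 < q1 t * p1 t + q2 t * p2 t →
        (∀ x ∈ Set.Icc 0 t, 0 < q1 x * p1 x + q2 x * p2 x ∨ nrm2 (q1 x) (q2 x) < 1.35) →
        (q1 t * p1 t + q2 t * p2 t) ^ 2 ≤ 2.002 * nrm2 (q1 t) (q2 t) := by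
  obtain ⟨v, q1, q2, p1, p2, hs, hl, hR, hS⟩ := exists_launch_family hμ0 hμ hδ0 hδ
  have hA := isOpen_setOf_exists_lt_and (R := fun κ t => nrm2 (q1 κ |t|) (q2 κ |t|))
    (S := fun κ t => q1 κ |t| * p1 κ |t| + q2 κ |t| * p2 κ |t|) hR hS
  have hB := isOpen_setOf_exists_forall_lt_or (R := fun κ t => nrm2 (q1 κ |t|) (q2 κ |t|))
    (S := fun κ t => q1 κ |t| * p1 κ |t| + q2 κ |t| * p2 κ |t|) hR hS
  have hl1 := hl (1 / 10) ⟨by norm_num, le_rfl⟩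
  have hl2 := hl (-(1 / 10)) ⟨le_rfl, by norm_num⟩
  by_contra! hcon
  have hAB := (isPreconnected_Icc : IsPreconnected (Set.Icc (-(1 / 10)) (1 / 10 : ℝ))) _ _ hA hB
    ?_ ⟨-(1 / 10), ⟨le_rfl, by norm_num⟩, ?_⟩ ⟨1 / 10, ⟨by norm_num, le_rfl⟩, ?_⟩
  · obtain ⟨κ, hκ, ⟨a, ha0, ha1, ha2⟩, b, hb0, hb1, hb2, hb3, hb4⟩ := hAB
    rcases le_total a b with hab | hab
    · rcases hb4 a ⟨ha0, hab⟩ with h | h <;> linarith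
    · rw [abs_of_nonneg hb0] at hb1 hb2 hb3
      rw [abs_of_nonneg ha0] at ha2
      linarith [(hs κ).dot_pos_of_escape (hl κ hκ) hb1 hb2 hb3 hab]
  · intro κ hκ
    by_contra hne
    obtain ⟨T, hE, hT⟩ := (hs κ).exists_ejection (hl κ hκ)
    obtain ⟨hneA, hneB⟩ := not_or.1 hne
    obtain ⟨t, ht0, ht1, ht2, ht3, ht4⟩ := hcon κ (v κ) T _ _ _ _ hE (hs κ) hT fun t ht h => by
      by_contra! hlt
      exact hneA ⟨t, ht, by simpa only [abs_of_nonneg ht] using h,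
        by simpa only [abs_of_nonneg ht] using hlt⟩
    refine hneB ⟨t, ht0, ?_⟩
    simp only [abs_of_nonneg ht0]
    refine ⟨ht1, ht2, ht4, fun x hx => ?_⟩
    simpa only [abs_of_nonneg hx.1] using ht3 x hx
  · obtain ⟨T, hE, hT⟩ := (hs _).exists_ejection hl2
    by_contra hneA
    refine hE.energy_ne_of_no_turn (hs _) hT (fun t ht h => ?_) rfl
    by_contra! hlt
    exact hneA ⟨t, ht, by simpa only [abs_of_nonneg ht] using h,
      by simpa only [abs_of_nonneg ht] using hlt⟩
  · obtain ⟨T, hE, hT⟩ := (hs _).exists_ejection hl1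
    refine ⟨T, hE.time_nonneg, ?_⟩
    simp only [abs_of_nonneg hE.time_nonneg]
    have hr := hE.le_nrm2 hT
    refine ⟨by linarith, hE.dot_pos (by linarith), hE.escape_of_energy_eq (hs _) hT rfl,
      fun x hx => ?_⟩
    simpa only [abs_of_nonneg hx.1] using hE.dot_pos_or_lt hx
/-- There is `μ₀ ∈ (0,1/2]` such that for every `μ ∈ (0,μ₀)` and every `ε > 0` the PCRTBP
has a globally defined solution which is parabolic in both time directions
(`‖q(t)‖ → ∞` and `‖p(t)‖ → 0` as `t → ±∞`) and passes `ε`-close to collision with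
the first primary. -/
theorem doubly_parabolic_orbits_close_to_collision :
    ∃ μ₀ : ℝ, μ₀ ∈ Set.Ioc (0 : ℝ) (1 / 2) ∧
      ∀ μ ∈ Set.Ioo (0 : ℝ) μ₀, ∀ ε : ℝ, 0 < ε →
        ∃ q1 q2 p1 p2 : ℝ → ℝ,
          IsPCRTBPSol μ Set.univ q1 q2 p1 p2 ∧
          Tendsto (fun t => nrm2 (q1 t) (q2 t)) atTop atTop ∧
          Tendsto (fun t => nrm2 (p1 t) (p2 t)) atTop (𝓝 0) ∧
          Tendsto (fun t => nrm2 (q1 t) (q2 t)) atBot atTop ∧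
          Tendsto (fun t => nrm2 (p1 t) (p2 t)) atBot (𝓝 0) ∧
          (∀ c : ℝ, ε < c → ∃ t : ℝ, nrm2 (q1 t + μ) (q2 t) < c) := by
  refine ⟨1 / 10 ^ 9, ⟨by norm_num, by norm_num⟩, fun μ hμ ε hε => ?_⟩
  obtain ⟨hμ0, hμ1⟩ := hμ
  have hδ0 : 0 < min ε (μ ^ 2 / 4) := lt_min hε (by positivity)
  obtain ⟨κ, v, T, q1, q2, p1, p2, hE, hs, hT, hA, hB⟩ :=
    exists_parabolic hμ0 hμ1 hδ0 (min_le_right _ _)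
  have hrev := hs.eq_reverse hμ0.le (by linarith) (half_pos hδ0) hE.q2_zero hE.p1_zero
  have hq : ∀ t, nrm2 (q1 (-t)) (q2 (-t)) = nrm2 (q1 t) (q2 t) := fun t => by
    rw [← (hrev t).1, ← (hrev t).2.1, nrm2, nrm2, neg_sq]
  have hp : ∀ t, nrm2 (p1 (-t)) (p2 (-t)) = nrm2 (p1 t) (p2 t) := fun t => by
    rw [← (hrev t).2.2.1, ← (hrev t).2.2.2, nrm2, nrm2, neg_sq]
  have h1 := hE.tendsto_nrm2 hs hT hA hB
  have h2 := hE.tendsto_nrm2_momentum hs hT hA hB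
  refine ⟨q1, q2, p1, p2, (hE.isPCRTBPSol_nonneg hs hT hA).univ_of_reversible hrev, h1, h2,
    (h1.comp tendsto_neg_atBot_atTop).congr hq, (h2.comp tendsto_neg_atBot_atTop).congr hp,
    fun c hc => ⟨0, ?_⟩⟩
  exact (hE.dS_zero.trans_le (min_le_left _ _)).trans_lt hc
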